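/- arXiv:1804.05035 — 3 statements merged into one kernel-verified Lean document; each statement's English description precedes it below -/
import Mathlib

section
/- Let d ≥ 2, 0 < δ < a < b, X = X(A,a,b,δ), x ∈ X_p, and let 1 ≤ k with 2kR < 2b(k+1) where R = √(b²+(d−1)a²). Then the cluster group S_x(2kR) is isomorphic to C₂^{d−k−1} ⋊ S_{d−k−1} (the full symmetry group of the (d−k−1)-crosspolytope on the basis vectors of E not used in the construction of the 2k+1 layers around X_p) if 1 ≤ k ≤ d−2, and is trivial if k ≥ d−1. In particular this holds when a² < 2b²/(k(d−1)). -/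
noncomputable section
open scoped Pointwise

/-- Euclidean d-space. -/
abbrev Euc (d : ℕ) : Type := EuclideanSpace ℝ (Fin d)

/-- The 1-based standard basis vector `e_k` of `ℝ^d` (for `1 ≤ k ≤ d`). -/
def eVec (d k : ℕ) : Euc d :=
  if h : k - 1 < d then EuclideanSpace.single ⟨k - 1, h⟩ (1 : ℝ) else 0

/-- Conditions (A1)–(A3) on the doubly-infinite integer sequence `A`. -/
def EngelSeq (d : ℕ) (A : ℤ → ℤ) : Prop :=
  (∀ i : ℤ, 1 ≤ (A i).natAbs ∧ (A i).natAbs ≤ d - 1) ∧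
  (∀ i : ℤ, (A (i + (d - 1))).natAbs = (A i).natAbs) ∧
  (∀ s : ℕ, 1 ≤ s → s ≤ d - 1 → ∃ i : ℤ, 1 ≤ i ∧ i ≤ d - 1 ∧ (A i).natAbs = s)

/-- The vector `u_i = sign(a_i) e_{|a_i|}`. -/
def engelU (d : ℕ) (A : ℤ → ℤ) (i : ℤ) : Euc d :=
  (if 0 < A i then (1 : ℝ) else -1) • eVec d (A i).natAbs

/-- The cumulative sum `u_1 + ⋯ + u_i` (with the natural convention for `i ≤ 0`,
so that `engelCum 0 = 0` and `engelCum i - engelCum (i-1) = u_i` for all `i`). -/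
def engelCum (d : ℕ) (A : ℤ → ℤ) (i : ℤ) : Euc d :=
  if 0 ≤ i then ∑ j ∈ Finset.range i.toNat, engelU d A ((j : ℤ) + 1)
  else -∑ j ∈ Finset.range (-i).toNat, engelU d A (-(j : ℤ))

/-- The translation vector placing layer `m` of an Engel set:
layer `m` lies at height `2bm`, and the horizontal shifts `δ·u_i` accumulate
according to (E3), (E4). (Integer division is floor division.) -/
def engelOffset (d : ℕ) (A : ℤ → ℤ) (b δ : ℝ) (m : ℤ) : Euc d :=
  ((2 * b) * (m : ℝ)) • eVec d d + δ • engelCum d A (m / 2)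

/-- The horizontal grid `Y = 2aℤ^{d-1} × {0}` in `ℝ^d`. -/
def engelGrid (d : ℕ) (a : ℝ) : Set (Euc d) :=
  {x | ∀ j : Fin d, ((j : ℕ) < d - 1 → ∃ m : ℤ, x j = 2 * a * (m : ℝ)) ∧
        ((j : ℕ) = d - 1 → x j = 0)}

/-- Layer `X_m` of the Engel set `X(A,a,b,δ)`. -/
def engelLayer (d : ℕ) (A : ℤ → ℤ) (a b δ : ℝ) (m : ℤ) : Set (Euc d) :=
  engelOffset d A b δ m +ᵥ engelGrid d a

/-- The Engel set `X(A,a,b,δ) = ⋃_m X_m`. -/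
def engelSet (d : ℕ) (A : ℤ → ℤ) (a b δ : ℝ) : Set (Euc d) :=
  ⋃ m : ℤ, engelLayer d A a b δ m

/-- A Delone set of type `(r,R)`: every open `r`-ball contains at most one point of `X`,
and every closed `R`-ball contains at least one point of `X`. -/
def IsDeloneSet {V : Type*} [MetricSpace V] (X : Set V) (r R : ℝ) : Prop :=
  (∀ y : V, (X ∩ Metric.ball y r).Subsingleton) ∧
  (∀ y : V, (X ∩ Metric.closedBall y R).Nonempty)

/-- The ρ-cluster of `X` at `x`. -/
def cluster {V : Type*} [MetricSpace V] (X : Set V) (x : V) (ρ : ℝ) : Set V :=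
  X ∩ Metric.closedBall x ρ

/-- Equivalence of the ρ-clusters of `X` at `x` and `x'`: an isometry of the ambient
space carries the one cluster onto the other, mapping center to center. -/
def ClustersEquiv {V : Type*} [MetricSpace V] (X : Set V) (x x' : V) (ρ : ℝ) : Prop :=
  ∃ g : V ≃ᵢ V, g x = x' ∧ g '' cluster X x ρ = cluster X x' ρ

/-- A regular system: the symmetry group of `X` acts transitively on `X`. -/
def IsRegularSystem {V : Type*} [MetricSpace V] (X : Set V) : Prop :=
  ∀ x ∈ X, ∀ y ∈ X, ∃ g : V ≃ᵢ V, g '' X = X ∧ g x = y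

/-- The cluster group `S_x(ρ)`: isometries of the ambient space fixing `x` and
mapping the cluster `C_x(ρ)` onto itself. -/
def clusterGroup {V : Type*} [MetricSpace V] (X : Set V) (x : V) (ρ : ℝ) :
    Subgroup (V ≃ᵢ V) where
  carrier := {g | g x = x ∧ g '' cluster X x ρ = cluster X x ρ}
  one_mem' := by
    refine ⟨rfl, ?_⟩
    show id '' _ = _
    rw [Set.image_id]
  mul_mem' := by
    rintro g h ⟨hg1, hg2⟩ ⟨hh1, hh2⟩
    constructor
    · show g (h x) = x
      rw [hh1, hg1]
    · show (⇑g ∘ ⇑h) '' _ = _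
      rw [Set.image_comp, hh2, hg2]
  inv_mem' := by
    rintro g ⟨hg1, hg2⟩
    constructor
    · show g.symm x = x
      conv_lhs => rw [← hg1]
      exact g.symm_apply_apply x
    · show g.symm '' _ = _
      conv_lhs => rw [← hg2, ← Set.image_comp]
      have : (⇑g.symm ∘ ⇑g) = id := by
        funext z
        exact g.symm_apply_apply z
      rw [this, Set.image_id]

/-- The natural action of `Perm (Fin m)` on `Fin m → Multiplicative (ZMod 2)` by
permuting coordinates, as a map into the automorphism group. -/
def permMulAut (m : ℕ) :
    Equiv.Perm (Fin m) →* MulAut (Fin m → Multiplicative (ZMod 2)) where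
  toFun σ :=
    { toFun := fun f => f ∘ σ.symm
      invFun := fun f => f ∘ σ
      left_inv := fun f => by ext i; simp
      right_inv := fun f => by ext i; simp
      map_mul' := fun f g => rfl }
  map_one' := by ext f i; rfl
  map_mul' := fun σ τ => by ext f i; rfl

/-- The hyperoctahedral group `C₂^m ⋊ S_m` (symmetry group of the `m`-crosspolytope). -/
def hyperoctahedralGroup (m : ℕ) : Type :=
  (Fin m → Multiplicative (ZMod 2)) ⋊[permMulAut m] Equiv.Perm (Fin m)

instance (m : ℕ) : Group (hyperoctahedralGroup m) :=
  inferInstanceAs (Group ((Fin m → Multiplicative (ZMod 2)) ⋊[permMulAut m] Equiv.Perm (Fin m)))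

section Sequence

variable {d : ℕ} {A : ℤ → ℤ}

theorem EngelSeq.natAbs_add_mul (hA : EngelSeq d A) (i q : ℤ) :
    (A (i + q * ((d : ℤ) - 1))).natAbs = (A i).natAbs := by
  have h : Function.Periodic (fun i => (A i).natAbs) ((d : ℤ) - 1) := hA.2.1
  exact h.int_mul q i

/-- Any `d - 1` consecutive terms of an Engel sequence have distinct absolute values. -/
theorem EngelSeq.eq_of_natAbs_eq (hd : 2 ≤ d) (hA : EngelSeq d A) {m m' : ℤ}
    (h : (A m).natAbs = (A m').natAbs) (h1 : m - m' < (d : ℤ) - 1) (h2 : m' - m < (d : ℤ) - 1) :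
    m = m' := by
  set N : ℤ := (d : ℤ) - 1 with hN
  have hN0 : 0 < N := by omega
  have hinj : Set.InjOn (fun i => (A i).natAbs) (Finset.Icc (1 : ℤ) N : Finset ℤ) := by
    refine Finset.injOn_of_surjOn_of_card_le (t := Finset.Icc 1 (d - 1)) _ ?_ ?_ ?_
    · intro i _
      simpa using hA.1 i
    · intro s hs
      simp only [Finset.coe_Icc, Set.mem_Icc] at hs
      obtain ⟨i, hi1, hi2, hi3⟩ := hA.2.2 s hs.1 hs.2
      exact ⟨i, by simpa using ⟨hi1, hi2⟩, hi3⟩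
    · simp
      omega
  have hred : ∀ i : ℤ, (A ((i - 1) % N + 1)).natAbs = (A i).natAbs := by
    intro i
    rw [← hA.natAbs_add_mul ((i - 1) % N + 1) ((i - 1) / N)]
    congr 2
    have := Int.emod_add_mul_ediv (i - 1) N
    linarith [mul_comm N ((i - 1) / N)]
  have hmem : ∀ i : ℤ, (i - 1) % N + 1 ∈ ((Finset.Icc (1 : ℤ) N : Finset ℤ) : Set ℤ) := by
    intro i
    have h0 := Int.emod_nonneg (i - 1) hN0.ne'
    have h3 := Int.emod_lt_of_pos (i - 1) hN0
    simp only [Finset.coe_Icc, Set.mem_Icc]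
    omega
  have key := hinj (hmem m) (hmem m') (by simp only [hred, h])
  have hdvd : N ∣ (m - 1) - (m' - 1) :=
    Int.ModEq.dvd (show (m' - 1) % N = (m - 1) % N by omega)
  obtain ⟨q, hq⟩ := hdvd
  have hq0 : q = 0 := by
    have : q < 1 := by
      by_contra! hc
      nlinarith
    have : -1 < q := by
      by_contra! hc
      nlinarith
    omega
  subst hq0
  omega

theorem eVec_apply {n : ℕ} (h1 : 1 ≤ n) (i : Fin d) :
    eVec d n i = if (i : ℕ) + 1 = n then 1 else 0 := by
  unfold eVec
  split_ifs with h2 h3 h3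
  · simp [Fin.ext_iff]
    omega
  · simp [Fin.ext_iff]
    omega
  · omega
  · rfl

/-- The sign occurring in `engelU`. -/
def engelSign (A : ℤ → ℤ) (m : ℤ) : ℝ := if 0 < A m then 1 else -1

theorem engelSign_eq (A : ℤ → ℤ) (m : ℤ) : engelSign A m = 1 ∨ engelSign A m = -1 := by
  unfold engelSign
  split_ifs <;> simp

theorem engelU_apply (hA : EngelSeq d A) (m : ℤ) (i : Fin d) :
    engelU d A m i = if (i : ℕ) + 1 = (A m).natAbs then engelSign A m else 0 := by
  rw [engelU, PiLp.smul_apply, eVec_apply (hA.1 m).1 i, smul_eq_mul, mul_ite, mul_one, mul_zero,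
    engelSign]

theorem engelCum_add_one (d : ℕ) (A : ℤ → ℤ) (m : ℤ) :
    engelCum d A (m + 1) = engelCum d A m + engelU d A (m + 1) := by
  unfold engelCum
  rcases lt_trichotomy m (-1) with h | h | h
  · rw [if_neg (by omega), if_neg (by omega)]
    have h1 : (-m).toNat = (-(m + 1)).toNat + 1 := by omega
    rw [h1, Finset.sum_range_succ]
    have h2 : -(((-(m + 1)).toNat : ℕ) : ℤ) = m + 1 := by omega
    rw [h2]
    abel
  · subst h
    simp
  · rw [if_pos (by omega), if_pos (by omega)]
    have h1 : (m + 1).toNat = m.toNat + 1 := by omega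
    rw [h1, Finset.sum_range_succ]
    have h2 : ((m.toNat : ℕ) : ℤ) = m := by omega
    rw [h2]

theorem engelCum_sub (d : ℕ) (A : ℤ → ℤ) {s t : ℤ} (h : s ≤ t) :
    engelCum d A t - engelCum d A s = ∑ m ∈ Finset.Ioc s t, engelU d A m := by
  induction t, h using Int.leInduction with
  | base => simp
  | succ t h ih =>
    rw [engelCum_add_one, ← Finset.insert_Ioc_right_eq_Ioc_add_one h, Finset.sum_insert (by simp), ← ih]
    abel

theorem engelCum_sub_apply (hA : EngelSeq d A) {s t : ℤ} (h : s ≤ t) (i : Fin d) :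
    engelCum d A t i - engelCum d A s i =
      ∑ m ∈ Finset.Ioc s t, if (i : ℕ) + 1 = (A m).natAbs then engelSign A m else 0 := by
  rw [← PiLp.sub_apply, engelCum_sub d A h]
  simp [engelU_apply hA]

theorem engelCum_apply_eq_of_unused (hA : EngelSeq d A) {s t : ℤ} (h : s ≤ t) (i : Fin d)
    (hi : ∀ m ∈ Finset.Ioc s t, (A m).natAbs ≠ (i : ℕ) + 1) :
    engelCum d A t i = engelCum d A s i := by
  rw [← sub_eq_zero, engelCum_sub_apply hA h]
  exact Finset.sum_eq_zero fun m hm => if_neg (hi m hm).symm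

theorem engelCum_last (hA : EngelSeq d A) (m : ℤ) (i : Fin d) (hi : (i : ℕ) = d - 1) :
    engelCum d A m i = 0 := by
  have h0 : engelCum d A 0 i = 0 := by simp [engelCum]
  have hne : ∀ m, (A m).natAbs ≠ (i : ℕ) + 1 := fun m => by
    have := hA.1 m
    omega
  rcases le_total 0 m with h | h
  · rw [engelCum_apply_eq_of_unused hA h i fun m _ => hne m, h0]
  · rw [← engelCum_apply_eq_of_unused hA h i fun m _ => hne m, h0]

theorem abs_engelCum_sub_le (hd : 2 ≤ d) (hA : EngelSeq d A) {s t : ℤ} (h : s ≤ t)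
    (hst : t - s ≤ (d : ℤ) - 1) (i : Fin d) :
    |engelCum d A t i - engelCum d A s i| ≤ 1 := by
  by_cases hu : ∀ m ∈ Finset.Ioc s t, (A m).natAbs ≠ (i : ℕ) + 1
  · rw [engelCum_apply_eq_of_unused hA h i hu]
    simp
  · push Not at hu
    obtain ⟨m, hm, hmi⟩ := hu
    rw [engelCum_sub_apply hA h, Finset.sum_eq_single_of_mem m hm]
    · rw [if_pos hmi.symm]
      rcases engelSign_eq A m with h | h <;> simp [h]
    · intro m' hm' hne
      refine if_neg fun h' => hne ?_
      rw [Finset.mem_Ioc] at hm hm'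
      exact hA.eq_of_natAbs_eq hd (by omega) (by omega) (by omega)

theorem abs_engelCum_sub_le' (hd : 2 ≤ d) (hA : EngelSeq d A) {s t : ℤ}
    (h1 : t - s ≤ (d : ℤ) - 1) (h2 : s - t ≤ (d : ℤ) - 1) (i : Fin d) :
    |engelCum d A t i - engelCum d A s i| ≤ 1 := by
  rcases le_total s t with h | h
  · exact abs_engelCum_sub_le hd hA h h1 i
  · rw [abs_sub_comm]
    exact abs_engelCum_sub_le hd hA h h2 i

end Sequence

theorem mem_engelLayer {d : ℕ} {A : ℤ → ℤ} (hd : 2 ≤ d) (hA : EngelSeq d A) {a b δ : ℝ} {m : ℤ}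
    {y : Euc d} : y ∈ engelLayer d A a b δ m ↔ ∀ i : Fin d,
      ((i : ℕ) < d - 1 → ∃ z : ℤ, y i = 2 * a * z + δ * engelCum d A (m / 2) i) ∧
      ((i : ℕ) = d - 1 → y i = 2 * b * m) := by
  rw [engelLayer, Set.mem_vadd_set_iff_neg_vadd_mem]
  refine forall_congr' fun i => and_congr (imp_congr_right fun hi => exists_congr fun z => ?_)
    (imp_congr_right fun hi => ?_)
  · have : ¬ (i : ℕ) + 1 = d := by omega
    simp [engelOffset, eVec_apply (show 1 ≤ d by omega), this]
    constructor <;> intro h <;> linarith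
  · have : (i : ℕ) + 1 = d := by omega
    simp [engelOffset, eVec_apply (show 1 ≤ d by omega), this, engelCum_last hA _ i hi]
    constructor <;> intro h <;> linarith

/-- The points of an Engel set, relative to a point of the layer `p`. -/
theorem add_mem_engelSet {d : ℕ} {A : ℤ → ℤ} (hd : 2 ≤ d) (hA : EngelSeq d A) {a b δ : ℝ}
    {p : ℤ} {x : Euc d} (hx : x ∈ engelLayer d A a b δ p) {v : Euc d} :
    x + v ∈ engelSet d A a b δ ↔ ∃ j : ℤ, ∀ i : Fin d,
      ((i : ℕ) < d - 1 → ∃ z : ℤ, v i = 2 * a * z +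
        δ * (engelCum d A ((p + j) / 2) i - engelCum d A (p / 2) i)) ∧
      ((i : ℕ) = d - 1 → v i = 2 * b * j) := by
  rw [engelSet, Set.mem_iUnion, (Equiv.addLeft p).surjective.exists]
  rw [mem_engelLayer hd hA] at hx
  refine exists_congr fun j => ?_
  rw [mem_engelLayer hd hA]
  refine forall_congr' fun i => and_congr (imp_congr_right fun hi => ?_)
    (imp_congr_right fun hi => ?_)
  · obtain ⟨z₀, h₀⟩ := (hx i).1 hi
    simp only [PiLp.add_apply, h₀, Equiv.coe_addLeft]
    constructor
    · rintro ⟨z, hz⟩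
      exact ⟨z - z₀, by push_cast; linarith⟩
    · rintro ⟨z, hz⟩
      exact ⟨z + z₀, by push_cast; linarith⟩
  · have h₀ := (hx i).2 hi
    simp only [PiLp.add_apply, h₀, Equiv.coe_addLeft]
    push_cast
    constructor <;> intro h <;> linarith

section SignedPerm

variable {d : ℕ}

/-- The isometry of `ℝ^d` fixing `x` and acting on `y - x` by permuting the coordinates
according to `τ` and then changing signs according to `s`. -/
def signedPerm (x : Euc d) (s : Fin d → ℤˣ) (τ : Equiv.Perm (Fin d)) : Euc d ≃ᵢ Euc d :=
  IsometryEquiv.mk'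
    (fun y => WithLp.toLp 2 fun i => x i + ((s i : ℤ) : ℝ) * (y (τ⁻¹ i) - x (τ⁻¹ i)))
    (fun y => WithLp.toLp 2 fun i => x i + ((s (τ i) : ℤ) : ℝ) * (y (τ i) - x (τ i)))
    (fun y => by
      ext i
      rcases Int.units_eq_one_or (s i) with h | h <;> simp [h])
    (Isometry.of_dist_eq fun y z => by
      rw [EuclideanSpace.dist_eq, EuclideanSpace.dist_eq,
        ← Equiv.sum_comp τ⁻¹ fun i => dist (y i) (z i) ^ 2]
      congr 1
      refine Finset.sum_congr rfl fun i _ => ?_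
      rcases Int.units_eq_one_or (s i) with h | h
      · simp [h]
      · simp [h, Real.dist_eq]
        ring)

theorem signedPerm_apply (x : Euc d) (s : Fin d → ℤˣ) (τ : Equiv.Perm (Fin d)) (y : Euc d)
    (i : Fin d) :
    signedPerm x s τ y i = x i + ((s i : ℤ) : ℝ) * (y (τ⁻¹ i) - x (τ⁻¹ i)) :=
  rfl

theorem signedPerm_add_apply (x : Euc d) (s : Fin d → ℤˣ) (τ : Equiv.Perm (Fin d)) (v : Euc d) :
    signedPerm x s τ (x + v) = x + WithLp.toLp 2 fun i => ((s i : ℤ) : ℝ) * v (τ⁻¹ i) := by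
  ext i
  simp [signedPerm_apply]

theorem signedPerm_self (x : Euc d) (s : Fin d → ℤˣ) (τ : Equiv.Perm (Fin d)) :
    signedPerm x s τ x = x := by
  ext i
  simp [signedPerm_apply]

theorem signedPerm_one (x : Euc d) : signedPerm x 1 1 = 1 := by
  ext y i
  simp only [signedPerm_apply, Pi.one_apply, Units.val_one, Int.cast_one, one_mul]
  exact add_sub_cancel _ _

theorem signedPerm_mul (x : Euc d) (s s' : Fin d → ℤˣ) (τ τ' : Equiv.Perm (Fin d)) :
    signedPerm x s τ * signedPerm x s' τ' =
      signedPerm x (fun i => s i * s' (τ⁻¹ i)) (τ * τ') := by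
  ext y i
  simp [signedPerm_apply, mul_assoc]
  rfl

theorem signedPerm_inv (x : Euc d) (s : Fin d → ℤˣ) (τ : Equiv.Perm (Fin d)) :
    (signedPerm x s τ)⁻¹ = signedPerm x (fun i => s (τ i)) τ⁻¹ := by
  rw [inv_eq_iff_mul_eq_one, signedPerm_mul, mul_inv_cancel, ← signedPerm_one]
  congr 1
  ext i
  simp

theorem signedPerm_inj {x : Euc d} {s s' : Fin d → ℤˣ} {τ τ' : Equiv.Perm (Fin d)} :
    signedPerm x s τ = signedPerm x s' τ' ↔ s = s' ∧ τ = τ' := by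
  refine ⟨fun h => ?_, fun h => by rw [h.1, h.2]⟩
  have key : ∀ i, s i = s' i ∧ τ⁻¹ i = τ'⁻¹ i := by
    intro i
    have h1 : signedPerm x s τ (x + EuclideanSpace.single (τ⁻¹ i) 1) i =
        signedPerm x s' τ' (x + EuclideanSpace.single (τ⁻¹ i) 1) i := by rw [h]
    simp only [signedPerm_add_apply, PiLp.add_apply, PiLp.single_apply, add_right_inj,
      if_true, mul_one, mul_ite, mul_zero] at h1
    split_ifs at h1 with h2
    · exact ⟨Units.ext (by exact_mod_cast h1), h2.symm⟩
    · exact absurd h1 (by simp)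
  refine ⟨funext fun i => (key i).1, inv_injective (Equiv.ext fun i => (key i).2)⟩

/-- The signed permutations about `x` acting trivially on the coordinates outside `H`. -/
def IsSignedPermOn (H : Fin d → Prop) (x : Euc d) (g : Euc d ≃ᵢ Euc d) : Prop :=
  ∃ (s : Fin d → ℤˣ) (τ : Equiv.Perm (Fin d)),
    (∀ i, ¬ H i → s i = 1 ∧ τ i = i) ∧ g = signedPerm x s τ

theorem IsSignedPermOn.inv {H : Fin d → Prop} {x : Euc d} {g : Euc d ≃ᵢ Euc d}
    (hg : IsSignedPermOn H x g) : IsSignedPermOn H x g⁻¹ := by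
  obtain ⟨s, τ, h, rfl⟩ := hg
  refine ⟨_, _, fun i hi => ⟨?_, ?_⟩, signedPerm_inv x s τ⟩
  · rw [(h i hi).2, (h i hi).1]
  · rw [Equiv.Perm.inv_eq_iff_eq, (h i hi).2]

/-- The group with two elements, as a group of signs. -/
def zmodTwoMulEquivUnits : Multiplicative (ZMod 2) ≃* ℤˣ :=
  mulEquivOfPrimeCardEq (p := 2) (by simp) (by simp [Nat.card_eq_fintype_card])

open Classical in
/-- Extension of a family of signs by `1`. -/
def extendSign {m : ℕ} {H : Fin d → Prop} (e : Fin m ≃ Subtype H)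
    (f : Fin m → Multiplicative (ZMod 2)) (i : Fin d) : ℤˣ :=
  if h : H i then zmodTwoMulEquivUnits (f (e.symm ⟨i, h⟩)) else 1

theorem extendSign_coe {m : ℕ} {H : Fin d → Prop} (e : Fin m ≃ Subtype H)
    (f : Fin m → Multiplicative (ZMod 2)) (i : Fin m) :
    extendSign e f (e i) = zmodTwoMulEquivUnits (f i) := by
  simp [extendSign, (e i).2]

theorem extendSign_of_not {m : ℕ} {H : Fin d → Prop} (e : Fin m ≃ Subtype H)
    (f : Fin m → Multiplicative (ZMod 2)) {i : Fin d} (hi : ¬ H i) : extendSign e f i = 1 :=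
  dif_neg hi

open Classical in
/-- The hyperoctahedral group acting on the coordinates in `H`. -/
def hyperoctahedralHom {m : ℕ} {H : Fin d → Prop} (e : Fin m ≃ Subtype H) (x : Euc d) :
    hyperoctahedralGroup m →* (Euc d ≃ᵢ Euc d) where
  toFun w := signedPerm x (extendSign e (SemidirectProduct.left w))
    ((SemidirectProduct.right w).extendDomain e)
  map_one' := by
    rw [← signedPerm_one x]
    congr 1
    · ext i
      by_cases hi : H i
      · obtain ⟨j, hj⟩ := e.surjective ⟨i, hi⟩
        obtain rfl : (e j : Fin d) = i := by rw [hj]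
        rw [extendSign_coe]
        exact congrArg _ (map_one zmodTwoMulEquivUnits)
      · rw [extendSign_of_not e _ hi]
        rfl
    · exact Equiv.Perm.extendDomain_one e
  map_mul' w w' := by
    rw [signedPerm_mul]
    congr 1
    · ext i
      by_cases hi : H i
      · obtain ⟨j, hj⟩ := e.surjective ⟨i, hi⟩
        obtain rfl : (e j : Fin d) = i := by rw [hj]
        rw [Equiv.Perm.extendDomain_inv, Equiv.Perm.extendDomain_apply_image, extendSign_coe,
          extendSign_coe, extendSign_coe, ← map_mul]
        rfl
      · rw [Equiv.Perm.extendDomain_inv, Equiv.Perm.extendDomain_apply_not_subtype _ _ hi,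
          extendSign_of_not e _ hi, extendSign_of_not e _ hi, extendSign_of_not e _ hi, mul_one]
    · exact (Equiv.Perm.extendDomain_mul e _ _).symm

theorem hyperoctahedralHom_injective {m : ℕ} {H : Fin d → Prop} (e : Fin m ≃ Subtype H)
    (x : Euc d) : Function.Injective (hyperoctahedralHom e x) := by
  classical
  intro w w' h
  obtain ⟨h1, h2⟩ := signedPerm_inj.1 h
  refine SemidirectProduct.ext (funext fun i => ?_)
    (Equiv.Perm.extendDomainHom_injective e h2)
  have := congrFun h1 (e i)
  rw [extendSign_coe, extendSign_coe] at this
  exact zmodTwoMulEquivUnits.injective this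

theorem mem_range_hyperoctahedralHom {m : ℕ} {H : Fin d → Prop} (e : Fin m ≃ Subtype H)
    (x : Euc d) (g : Euc d ≃ᵢ Euc d) :
    g ∈ (hyperoctahedralHom e x).range ↔ IsSignedPermOn H x g := by
  classical
  constructor
  · rintro ⟨w, rfl⟩
    exact ⟨_, _, fun i hi => ⟨extendSign_of_not e _ hi,
      Equiv.Perm.extendDomain_apply_not_subtype _ _ hi⟩, rfl⟩
  · rintro ⟨s, τ, h, rfl⟩
    have hτ : ∀ i, H (τ i) ↔ H i := by
      intro i
      refine ⟨fun h1 => ?_, fun h1 => ?_⟩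
      · by_contra h2
        exact h2 ((h i h2).2 ▸ h1)
      · by_contra h2
        exact h2 ((τ.injective (h _ h2).2).symm ▸ h1)
    refine ⟨SemidirectProduct.mk (fun i => zmodTwoMulEquivUnits.symm (s (e i)))
      (e.symm.permCongr (τ.subtypePerm hτ)), ?_⟩
    refine signedPerm_inj.2 ⟨funext fun i => ?_, Equiv.ext fun i => ?_⟩
    all_goals by_cases hi : H i
    · obtain ⟨j, hj⟩ := e.surjective ⟨i, hi⟩
      obtain rfl : (e j : Fin d) = i := by rw [hj]
      rw [extendSign_coe]
      simp
    · rw [extendSign_of_not e _ hi, (h i hi).1]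
    · obtain ⟨j, hj⟩ := e.surjective ⟨i, hi⟩
      obtain rfl : (e j : Fin d) = i := by rw [hj]
      rw [Equiv.Perm.extendDomain_apply_image]
      simp
    · rw [Equiv.Perm.extendDomain_apply_not_subtype _ _ hi, (h i hi).2]

end SignedPerm

/-- The horizontal coordinate directions not used by the shifts between the layers
`X_{p-k}, …, X_{p+k}`. -/
def EngelUnused (d : ℕ) (A : ℤ → ℤ) (p : ℤ) (k : ℕ) (i : Fin d) : Prop :=
  (i : ℕ) < d - 1 ∧ ∀ m ∈ Finset.Ioc ((p - k) / 2) ((p + k) / 2), (A m).natAbs ≠ (i : ℕ) + 1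

theorem card_engelUnused {d : ℕ} {A : ℤ → ℤ} (hd : 2 ≤ d) (hA : EngelSeq d A) (p : ℤ) {k : ℕ}
    (hk : k ≤ d - 1) : Nat.card (Subtype (EngelUnused d A p k)) = d - k - 1 := by
  classical
  set W := Finset.Ioc ((p - k) / 2) ((p + k) / 2) with hW
  have hcW : (W.image fun m => (A m).natAbs).card = k := by
    rw [Finset.card_image_of_injOn]
    · rw [hW, Int.card_Ioc]
      omega
    · intro m hm m' hm' h
      simp only [hW, Finset.coe_Ioc, Set.mem_Ioc] at hm hm'
      exact hA.eq_of_natAbs_eq hd h (by omega) (by omega)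
  have hsub : (W.image fun m => (A m).natAbs) ⊆ Finset.Icc 1 (d - 1) := by
    intro s hs
    obtain ⟨m, -, rfl⟩ := Finset.mem_image.1 hs
    exact Finset.mem_Icc.2 (hA.1 m)
  have hcard : (Finset.Icc 1 (d - 1) \ W.image fun m => (A m).natAbs).card = d - k - 1 := by
    rw [Finset.card_sdiff_of_subset hsub, hcW, Nat.card_Icc]
    omega
  rw [Nat.card_eq_fintype_card, Fintype.card_subtype, ← hcard]
  refine Finset.card_nbij (fun i => (i : ℕ) + 1) ?_ ?_ ?_
  · intro i hi
    simp only [Finset.coe_filter, Finset.mem_univ, true_and, Set.mem_ofPred_eq] at hi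
    simp only [Finset.coe_sdiff, Finset.coe_Icc, Finset.coe_image, Set.mem_sdiff, Set.mem_Icc,
      Set.mem_image, not_exists, not_and]
    exact ⟨⟨by omega, by have := hi.1; omega⟩, fun m hm => hi.2 m hm⟩
  · intro i _ j _ h
    exact Fin.ext (by simpa using h)
  · intro s hs
    simp only [Finset.coe_sdiff, Finset.coe_Icc, Finset.coe_image, Set.mem_sdiff, Set.mem_Icc,
      Set.mem_image, not_exists, not_and] at hs
    refine ⟨⟨s - 1, by omega⟩, ?_, by simp; omega⟩
    simp only [Finset.coe_filter, Finset.mem_univ, true_and, Set.mem_ofPred_eq]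
    refine ⟨by simp; omega, fun m hm h => hs.2 m hm (by simp at h; omega)⟩

section Cluster

variable {d : ℕ} {A : ℤ → ℤ} {a b δ : ℝ} {p : ℤ} {x : Euc d}

theorem IsSignedPermOn.add_mem_engelSet {k : ℕ} (hd : 2 ≤ d) (hA : EngelSeq d A) (hb : 0 < b)
    (hx : x ∈ engelLayer d A a b δ p) {ρ : ℝ} (hρ : ρ < 2 * b * ((k : ℝ) + 1)) {g : Euc d ≃ᵢ Euc d}
    (hg : IsSignedPermOn (EngelUnused d A p k) x g) {y : Euc d}
    (hy : y ∈ cluster (engelSet d A a b δ) x ρ) : g y ∈ cluster (engelSet d A a b δ) x ρ := by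
  obtain ⟨s, τ, h, rfl⟩ := hg
  obtain ⟨v, rfl⟩ : ∃ v, x + v = y := ⟨y - x, by abel⟩
  obtain ⟨hv, hvρ⟩ := hy
  refine ⟨?_, ?_⟩
  swap
  · have := (signedPerm x s τ).isometry.dist_eq (x + v) x
    rw [signedPerm_self] at this
    rwa [Metric.mem_closedBall, this]
  rw [signedPerm_add_apply, _root_.add_mem_engelSet hd hA hx]
  rw [_root_.add_mem_engelSet hd hA hx] at hv
  obtain ⟨j, hj⟩ := hv
  have hnorm : ‖v‖ ≤ ρ := by simpa [dist_eq_norm] using hvρ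
  have hlast := (hj ⟨d - 1, by omega⟩).2 rfl
  have hjk : |(j : ℝ)| < (k : ℝ) + 1 := by
    have h1 := (PiLp.norm_apply_le v ⟨d - 1, by omega⟩).trans_lt (hnorm.trans_lt hρ)
    rw [hlast, Real.norm_eq_abs, abs_mul, abs_of_pos (by positivity)] at h1
    exact lt_of_mul_lt_mul_left h1 (by positivity)
  have hjk' : |j| < (k : ℤ) + 1 := by exact_mod_cast hjk
  rw [abs_lt] at hjk'
  have hunused : ∀ i, EngelUnused d A p k i → ∃ z : ℤ, v i = 2 * a * z := by
    intro i hi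
    obtain ⟨z, hz⟩ := (hj i).1 hi.1
    refine ⟨z, ?_⟩
    have : engelCum d A ((p + j) / 2) i = engelCum d A (p / 2) i := by
      rcases le_total 0 j with h0 | h0
      · refine engelCum_apply_eq_of_unused hA (by omega) i fun m hm => hi.2 m ?_
        rw [Finset.mem_Ioc] at hm ⊢
        omega
      · refine (engelCum_apply_eq_of_unused hA (by omega) i fun m hm => hi.2 m ?_).symm
        rw [Finset.mem_Ioc] at hm ⊢
        omega
    rw [hz, this]
    ring
  refine ⟨j, fun i => ?_⟩
  by_cases hi : EngelUnused d A p k i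
  · refine ⟨fun _ => ?_, fun h' => absurd hi.1 (by omega)⟩
    have hτi : EngelUnused d A p k (τ⁻¹ i) := by
      by_contra hc
      have := (h _ hc).2
      exact hc (((τ.apply_symm_apply i).symm.trans this) ▸ hi)
    obtain ⟨z, hz⟩ := hunused _ hi
    obtain ⟨z', hz'⟩ := hunused _ hτi
    obtain ⟨z₁, hz₁⟩ := (hj i).1 hi.1
    have hD : δ * (engelCum d A ((p + j) / 2) i - engelCum d A (p / 2) i) =
        2 * a * z - 2 * a * z₁ := by linarith
    refine ⟨(s i : ℤ) * z' - z + z₁, ?_⟩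
    rw [hD]
    simp only [hz']
    push_cast
    ring
  · have hτi : τ⁻¹ i = i := by
      rw [Equiv.Perm.inv_eq_iff_eq, (h i hi).2]
    simp only [hτi, (h i hi).1, Units.val_one, Int.cast_one, one_mul]
    exact hj i

theorem IsSignedPermOn.mem_clusterGroup {k : ℕ} (hd : 2 ≤ d) (hA : EngelSeq d A) (hb : 0 < b)
    (hx : x ∈ engelLayer d A a b δ p) {ρ : ℝ} (hρ : ρ < 2 * b * ((k : ℝ) + 1)) {g : Euc d ≃ᵢ Euc d}
    (hg : IsSignedPermOn (EngelUnused d A p k) x g) :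
    g ∈ clusterGroup (engelSet d A a b δ) x ρ := by
  refine ⟨?_, Set.Subset.antisymm ?_ ?_⟩
  · obtain ⟨s, τ, -, rfl⟩ := hg
    exact signedPerm_self x s τ
  · rintro _ ⟨y, hy, rfl⟩
    exact hg.add_mem_engelSet hd hA hb hx hρ hy
  · intro y hy
    exact ⟨g⁻¹ y, hg.inv.add_mem_engelSet hd hA hb hx hρ hy, g.apply_symm_apply y⟩

/-- Every element of a cluster group is a linear isometry about the center of the cluster. -/
theorem exists_linearIsometryEquiv_of_mem_clusterGroup {X : Set (Euc d)} {ρ : ℝ}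
    {g : Euc d ≃ᵢ Euc d} (hg : g ∈ clusterGroup X x ρ) :
    ∃ T : Euc d ≃ₗᵢ[ℝ] Euc d, (∀ v, g (x + v) = x + T v) ∧
      ∀ v, x + v ∈ X → ‖v‖ ≤ ρ → x + T v ∈ X := by
  have key : ∀ v, g (x + v) = x + g.toRealAffineIsometryEquiv.linearIsometryEquiv v := by
    intro v
    have := g.toRealAffineIsometryEquiv.map_vadd x v
    rw [vadd_eq_add, vadd_eq_add, add_comm, IsometryEquiv.coeFn_toRealAffineIsometryEquiv,
      hg.1] at this
    rw [this, add_comm]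
  refine ⟨_, key, fun v hv hρ => ?_⟩
  have : g (x + v) ∈ cluster X x ρ := by
    rw [← hg.2]
    exact ⟨x + v, ⟨hv, by simpa [dist_eq_norm] using hρ⟩, rfl⟩
  rw [← key]
  exact this.1

/-- A grid vector of the same length as the shortest ones is parallel to a coordinate axis. -/
theorem exists_eq_single_of_norm_eq (hd : 2 ≤ d) (hA : EngelSeq d A) (ha : 0 < a) (hab : a < b)
    (hx : x ∈ engelLayer d A a b δ p) {w : Euc d} (hw : x + w ∈ engelSet d A a b δ)
    (hn : ‖w‖ = 2 * a) :
    ∃ (l : Fin d) (s : ℤˣ), (l : ℕ) < d - 1 ∧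
      w = (2 * a) • EuclideanSpace.single l ((s : ℤ) : ℝ) := by
  rw [add_mem_engelSet hd hA hx] at hw
  obtain ⟨j, hj⟩ := hw
  have hsq : ∑ i, w i ^ 2 = (2 * a) ^ 2 := by rw [← EuclideanSpace.real_norm_sq_eq, hn]
  have hlast := (hj ⟨d - 1, by omega⟩).2 rfl
  obtain rfl : j = 0 := by
    have h1 := PiLp.norm_apply_le w ⟨d - 1, by omega⟩
    rw [hlast, hn, Real.norm_eq_abs, abs_mul, abs_of_pos (by linarith : 0 < 2 * b)] at h1
    have : |(j : ℝ)| < 1 := by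
      by_contra! hc
      nlinarith
    exact Int.abs_lt_one_iff.1 (by exact_mod_cast this)
  obtain ⟨l, hl⟩ : ∃ l, w l ≠ 0 := by
    by_contra! hc
    have : 0 < (2 * a) ^ 2 := by positivity
    simp only [hc] at hsq
    simp only [ne_eq, OfNat.ofNat_ne_zero, not_false_eq_true, zero_pow,
      Finset.sum_const_zero] at hsq
    exact this.ne hsq
  have hld : (l : ℕ) < d - 1 := by
    by_contra hc
    exact hl (by rw [(hj l).2 (by omega)]; simp)
  obtain ⟨z, hz⟩ := (hj l).1 hld
  simp only [add_zero, sub_self, mul_zero] at hz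
  have hz0 : z ≠ 0 := by
    rintro rfl
    simp [hz] at hl
  have hz1 : (1 : ℝ) ≤ (z : ℝ) ^ 2 := by
    have : 0 < z ^ 2 := by positivity
    exact_mod_cast this
  rw [← Finset.add_sum_erase _ _ (Finset.mem_univ l), hz] at hsq
  have hrest : 0 ≤ ∑ i ∈ Finset.univ.erase l, w i ^ 2 := Finset.sum_nonneg fun i _ => sq_nonneg _
  have ha2 : 0 < (2 * a) ^ 2 := by positivity
  have hz2 : (z : ℝ) ^ 2 = 1 := by nlinarith
  have hrest0 : ∑ i ∈ Finset.univ.erase l, w i ^ 2 = 0 := by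
    rw [mul_pow, hz2] at hsq
    linarith
  rw [Finset.sum_eq_zero_iff_of_nonneg fun i _ => sq_nonneg _] at hrest0
  have hzu : IsUnit z := by
    have : z ^ 2 = 1 := by exact_mod_cast hz2
    exact IsUnit.of_pow_eq_one this two_ne_zero
  obtain ⟨s, rfl⟩ := hzu
  refine ⟨l, s, hld, ?_⟩
  ext i
  by_cases hi : i = l
  · subst hi
    simp [hz]
  · simpa [PiLp.single_apply, hi] using hrest0 i (by simp [hi])


theorem exists_signs_perm (hd : 2 ≤ d) (hA : EngelSeq d A) (ha : 0 < a) (hab : a < b)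
    (hx : x ∈ engelLayer d A a b δ p) {ρ : ℝ} (hρ : 2 * b ≤ ρ) {T : Euc d ≃ₗᵢ[ℝ] Euc d}
    (hT : ∀ v, x + v ∈ engelSet d A a b δ → ‖v‖ ≤ ρ → x + T v ∈ engelSet d A a b δ) :
    ∃ (s : Fin d → ℤˣ) (τ : Equiv.Perm (Fin d)),
      (∀ i, ((τ i : Fin d) : ℕ) < d - 1 ↔ (i : ℕ) < d - 1) ∧
      ∀ v i, T v (τ i) = ((s i : ℤ) : ℝ) * v i := by
  have hor : ∀ i : Fin d, (i : ℕ) < d - 1 → ∃ (l : Fin d) (s : ℤˣ), (l : ℕ) < d - 1 ∧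
      T (EuclideanSpace.single i 1) = EuclideanSpace.single l ((s : ℤ) : ℝ) := by
    intro i hi
    have hn : ‖(2 * a) • EuclideanSpace.single i (1 : ℝ)‖ = 2 * a := by
      rw [norm_smul, PiLp.norm_single, norm_one, mul_one, Real.norm_eq_abs,
        abs_of_pos (by positivity)]
    have hmem : x + (2 * a) • EuclideanSpace.single i (1 : ℝ) ∈ engelSet d A a b δ := by
      rw [add_mem_engelSet hd hA hx]
      refine ⟨0, fun i' => ⟨fun _ => ⟨if i' = i then 1 else 0, ?_⟩, fun h => ?_⟩⟩
      · simp [PiLp.single_apply]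
      · have : i' ≠ i := by
          rintro rfl
          omega
        simp [this]
    obtain ⟨l, s, hl, hs⟩ := exists_eq_single_of_norm_eq hd hA ha hab hx
      (hT _ hmem (by rw [hn]; linarith)) (by rw [T.norm_map, hn])
    refine ⟨l, s, hl, ?_⟩
    rw [map_smul] at hs
    exact smul_right_injective _ (by positivity : 2 * a ≠ 0) hs
  have hin : ∀ (i l : Fin d) (s : ℤˣ),
      T (EuclideanSpace.single i 1) = EuclideanSpace.single l ((s : ℤ) : ℝ) →
      ∀ v, T v l = ((s : ℤ) : ℝ) * v i := by
    intro i l s h v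
    have h1 := T.inner_map_map v (EuclideanSpace.single i 1)
    rw [h, EuclideanSpace.inner_single_right, EuclideanSpace.inner_single_right] at h1
    rcases Int.units_eq_one_or s with rfl | rfl
    · simpa using h1
    · simp at h1 ⊢
      linarith
  have hsurj : ∀ l : Fin d, (l : ℕ) < d - 1 → ∃ (i : Fin d) (s : ℤˣ), (i : ℕ) < d - 1 ∧
      T (EuclideanSpace.single i 1) = EuclideanSpace.single l ((s : ℤ) : ℝ) := by
    have : Nonempty (Fin d) := ⟨⟨0, by omega⟩⟩
    choose! f s hf hs using hor
    have hinj : Set.InjOn f (Finset.univ.filter fun i : Fin d => (i : ℕ) < d - 1 : Finset _) := by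
      intro i hi j hj hij
      simp only [Finset.coe_filter, Finset.mem_univ, true_and, Set.mem_ofPred_eq] at hi hj
      by_contra hne
      have h1 := hin i (f i) (s i) (hs i hi) (EuclideanSpace.single j 1)
      rw [hs j hj, hij] at h1
      simp [hne] at h1
    have := Finset.surjOn_of_injOn_of_card_le
      (t := Finset.univ.filter fun i : Fin d => (i : ℕ) < d - 1) f
      (fun i hi => by
        simp only [Finset.coe_filter, Finset.mem_univ, true_and, Set.mem_ofPred_eq] at hi ⊢
        exact hf i hi) hinj le_rfl
    intro l hl
    obtain ⟨i, hi, rfl⟩ := this (show l ∈ _ by simpa using hl)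
    simp only [Finset.coe_filter, Finset.mem_univ, true_and, Set.mem_ofPred_eq] at hi
    exact ⟨i, s i, hi, hs i hi⟩
  have hall : ∀ i : Fin d, ∃ (l : Fin d) (s : ℤˣ), ((l : ℕ) < d - 1 ↔ (i : ℕ) < d - 1) ∧
      T (EuclideanSpace.single i 1) = EuclideanSpace.single l ((s : ℤ) : ℝ) := by
    intro i
    by_cases hi : (i : ℕ) < d - 1
    · obtain ⟨l, s, hl, hs⟩ := hor i hi
      exact ⟨l, s, by simp [hi, hl], hs⟩
    · have hzero : ∀ l, l ≠ i → T (EuclideanSpace.single i 1) l = 0 := by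
        intro l hl
        have hld : (l : ℕ) < d - 1 := by
          have : (l : ℕ) ≠ i := fun h => hl (Fin.ext h)
          omega
        obtain ⟨j, s, hj, hs⟩ := hsurj l hld
        have hji : j ≠ i := by
          rintro rfl
          exact hi hj
        rw [hin j l s hs]
        simp [hji]
      have hsingle : T (EuclideanSpace.single i 1) =
          EuclideanSpace.single i (T (EuclideanSpace.single i 1) i) := by
        ext l
        by_cases hl : l = i
        · subst hl
          simp
        · simpa [PiLp.single_apply, hl] using hzero l hl
      have hone : |T (EuclideanSpace.single i 1) i| = 1 := by
        have := T.norm_map (EuclideanSpace.single i 1)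
        rwa [hsingle, PiLp.norm_single, PiLp.norm_single, norm_one, Real.norm_eq_abs] at this
      rcases eq_or_eq_neg_of_abs_eq hone with h | h
      · exact ⟨i, 1, Iff.rfl, by rw [hsingle, h]; simp⟩
      · exact ⟨i, -1, Iff.rfl, by rw [hsingle, h]; simp⟩
  choose f s hf hs using hall
  have hinj : Function.Injective f := by
    intro i j hij
    by_contra hne
    have h1 := hin i (f i) (s i) (hs i) (EuclideanSpace.single j 1)
    rw [hs j, hij] at h1
    simp [hne] at h1
  exact ⟨s, Equiv.ofBijective f (Finite.injective_iff_bijective.1 hinj), hf,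
    fun v i => hin i _ _ (hs i) v⟩

/-- The point of the layer `p + j` nearest to the vertical line through `x`, relative to `x`. -/
def nearestVec (d : ℕ) (A : ℤ → ℤ) (b δ : ℝ) (p j : ℤ) : Euc d :=
  WithLp.toLp 2 fun i => if (i : ℕ) < d - 1 then
    δ * (engelCum d A ((p + j) / 2) i - engelCum d A (p / 2) i) else 2 * b * j

theorem add_nearestVec_mem (hd : 2 ≤ d) (hA : EngelSeq d A) (hx : x ∈ engelLayer d A a b δ p)
    (j : ℤ) : x + nearestVec d A b δ p j ∈ engelSet d A a b δ := by
  rw [add_mem_engelSet hd hA hx]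
  refine ⟨j, fun i => ⟨fun hi => ⟨0, ?_⟩, fun hi => ?_⟩⟩
  · simp [nearestVec, hi]
  · simp [nearestVec, hi]

theorem norm_nearestVec_sq_le (hd : 2 ≤ d) (hA : EngelSeq d A) (hδ : 0 < δ) (hδa : δ < a)
    {j : ℤ} (hj : |j| ≤ (d : ℤ) - 1) :
    ‖nearestVec d A b δ p j‖ ^ 2 ≤ (2 * b * j) ^ 2 + ((d : ℝ) - 1) * a ^ 2 := by
  rw [abs_le] at hj
  rw [EuclideanSpace.real_norm_sq_eq,
    ← Finset.add_sum_erase _ _ (Finset.mem_univ (⟨d - 1, by omega⟩ : Fin d))]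
  have hle : ∀ i ∈ Finset.univ.erase (⟨d - 1, by omega⟩ : Fin d),
      nearestVec d A b δ p j i ^ 2 ≤ a ^ 2 := by
    intro i hi
    have hi' : (i : ℕ) < d - 1 := by
      have : (i : ℕ) ≠ d - 1 := fun h => (Finset.mem_erase.1 hi).1 (Fin.ext h)
      omega
    have hD := abs_engelCum_sub_le' hd hA (s := p / 2) (t := (p + j) / 2) (by omega) (by omega) i
    simp only [nearestVec, hi', if_true]
    rw [sq_le_sq, abs_mul, abs_of_pos hδ, abs_of_pos (hδ.trans hδa)]
    nlinarith
  have := Finset.sum_le_card_nsmul _ _ _ hle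
  rw [Finset.card_erase_of_mem (Finset.mem_univ _), Finset.card_univ, Fintype.card_fin,
    nsmul_eq_mul, Nat.cast_sub (by omega), Nat.cast_one] at this
  refine add_le_add (le_of_eq ?_) this
  simp [nearestVec]

theorem isSignedPermOn_of_mem_clusterGroup (hd : 2 ≤ d) (hA : EngelSeq d A) (hδ : 0 < δ)
    (hδa : δ < a) (hab : a < b) (hx : x ∈ engelLayer d A a b δ p) {k : ℕ} (hk : 1 ≤ k)
    (hkd : k ≤ d - 1) {ρ : ℝ} (hρ0 : 0 ≤ ρ)
    (hρ : (2 * b * k) ^ 2 + ((d : ℝ) - 1) * a ^ 2 ≤ ρ ^ 2) {g : Euc d ≃ᵢ Euc d}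
    (hg : g ∈ clusterGroup (engelSet d A a b δ) x ρ) :
    IsSignedPermOn (EngelUnused d A p k) x g := by
  have ha : 0 < a := hδ.trans hδa
  have hb : 0 < b := ha.trans hab
  have hd1 : (0 : ℝ) ≤ (d : ℝ) - 1 := by
    have : (2 : ℝ) ≤ d := by exact_mod_cast hd
    linarith
  have hk1 : (1 : ℝ) ≤ k := by exact_mod_cast hk
  obtain ⟨T, hgT, hT⟩ := exists_linearIsometryEquiv_of_mem_clusterGroup hg
  have h2b : 2 * b ≤ ρ := by
    refine (sq_le_sq₀ (by positivity) hρ0).1 (le_trans ?_ hρ)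
    have h1 : 2 * b ≤ 2 * b * k := by nlinarith
    have h2 : (2 * b) ^ 2 ≤ (2 * b * k) ^ 2 := pow_le_pow_left₀ (by positivity) h1 2
    have h3 : 0 ≤ ((d : ℝ) - 1) * a ^ 2 := by positivity
    linarith
  obtain ⟨s, τ, hτ, hs⟩ := exists_signs_perm hd hA ha hab hx h2b hT
  have hnear : ∀ j : ℤ, |j| ≤ k →
      x + T (nearestVec d A b δ p j) ∈ engelSet d A a b δ := by
    intro j hj
    refine hT _ (add_nearestVec_mem hd hA hx j) ((sq_le_sq₀ (norm_nonneg _) hρ0).1 ?_)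
    refine (norm_nearestVec_sq_le hd hA hδ hδa (by omega)).trans (le_trans ?_ hρ)
    have h1 : (|(j : ℝ)|) ≤ k := by exact_mod_cast hj
    have h2 : (2 * b * j) ^ 2 ≤ (2 * b * k) ^ 2 := by
      rw [sq_le_sq, abs_mul, abs_of_pos (by positivity : 0 < 2 * b),
        abs_of_nonneg (by positivity : 0 ≤ 2 * b * k)]
      gcongr
    linarith
  have hsign : ∀ i : Fin d, ((s i : ℤ) : ℝ) = 1 ∨ ((s i : ℤ) : ℝ) = -1 := by
    intro i
    rcases Int.units_eq_one_or (s i) with h | h <;> simp [h]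
  -- an element of the cluster group cannot reverse the vertical direction
  have hlast : ∀ i : Fin d, (i : ℕ) = d - 1 → τ i = i ∧ s i = 1 := by
    intro i hi
    have hτi : τ i = i := by
      have := hτ i
      have := (τ i).2
      exact Fin.ext (by omega)
    refine ⟨hτi, (Int.units_eq_one_or (s i)).resolve_right fun hsi => ?_⟩
    obtain ⟨ε, hε, hε2⟩ : ∃ ε : ℤ, |ε| = 1 ∧ (p + ε) / 2 = p / 2 := by
      rcases Int.even_or_odd p with ⟨q, hq⟩ | ⟨q, hq⟩
      · exact ⟨1, by simp, by omega⟩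
      · exact ⟨-1, by simp, by omega⟩
    have hmem := hnear ε (by omega)
    rw [add_mem_engelSet hd hA hx] at hmem
    obtain ⟨j, hj⟩ := hmem
    have hj0 : j = -ε := by
      have h1 := (hj i).2 hi
      have h2 := hs (nearestVec d A b δ p ε) i
      rw [hτi, h1, hsi] at h2
      simp [nearestVec, hi] at h2
      have h3 : (2 * b) * j = (2 * b) * ((-ε : ℤ) : ℝ) := by
        push_cast
        linarith
      exact_mod_cast mul_left_cancel₀ (by positivity : 2 * b ≠ 0) h3
    obtain ⟨m, hm⟩ : ∃ m : ℤ, ((p + j) / 2 = m ∧ p / 2 = m - 1) ∨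
        ((p + j) / 2 = m - 1 ∧ p / 2 = m) := by
      rcases abs_eq (zero_le_one' ℤ) |>.1 hε with h | h
      · exact ⟨p / 2, Or.inr (by omega)⟩
      · exact ⟨p / 2 + 1, Or.inl (by omega)⟩
    have hAm := hA.1 m
    set l : Fin d := ⟨(A m).natAbs - 1, by omega⟩ with hl
    have hld : (l : ℕ) < d - 1 := by
      simp only [hl]
      omega
    have hU : engelCum d A m l = engelCum d A (m - 1) l + engelSign A m := by
      have := engelCum_add_one d A (m - 1)
      rw [sub_add_cancel] at this
      rw [this, PiLp.add_apply, engelU_apply hA, if_pos (by simp only [hl]; omega)]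
    obtain ⟨z, hz⟩ := (hj l).1 hld
    have hTl : T (nearestVec d A b δ p ε) l = 0 := by
      have h1 := hs (nearestVec d A b δ p ε) (τ⁻¹ l)
      have h2 : τ (τ⁻¹ l) = l := τ.apply_symm_apply l
      have h3 := hτ (τ⁻¹ l)
      rw [h2] at h1 h3
      rw [h1]
      simp only [nearestVec, h3.1 hld, if_true, hε2, sub_self, mul_zero]
    rw [hTl] at hz
    have hz' : |2 * a * (z : ℝ)| = δ := by
      rcases hm with ⟨h1, h2⟩ | ⟨h1, h2⟩ <;> rw [h1, h2, hU] at hz <;>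
        rcases engelSign_eq A m with h | h <;> rw [h] at hz
      · rw [show 2 * a * (z : ℝ) = -δ by linarith, abs_neg, abs_of_pos hδ]
      · rw [show 2 * a * (z : ℝ) = δ by linarith, abs_of_pos hδ]
      · rw [show 2 * a * (z : ℝ) = δ by linarith, abs_of_pos hδ]
      · rw [show 2 * a * (z : ℝ) = -δ by linarith, abs_neg, abs_of_pos hδ]
    rw [abs_mul, abs_of_pos (by positivity : 0 < 2 * a)] at hz'
    have hz1 : |(z : ℝ)| < 1 := by
      by_contra! hc
      nlinarith
    obtain rfl : z = 0 := Int.abs_lt_one_iff.1 (by exact_mod_cast hz1)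
    simp at hz'
    exact hδ.ne hz'
  have hcum : ∀ j : ℤ, |j| ≤ k → ∀ i : Fin d, (i : ℕ) < d - 1 →
      ((s i : ℤ) : ℝ) * (engelCum d A ((p + j) / 2) i - engelCum d A (p / 2) i) =
        engelCum d A ((p + j) / 2) (τ i) - engelCum d A (p / 2) (τ i) := by
    intro j hj i hi
    have hmem := hnear j hj
    rw [add_mem_engelSet hd hA hx] at hmem
    obtain ⟨j', hj'⟩ := hmem
    have hjj : j' = j := by
      have hl := hlast ⟨d - 1, by omega⟩ rfl
      have h1 := (hj' ⟨d - 1, by omega⟩).2 rfl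
      have h2 := hs (nearestVec d A b δ p j) ⟨d - 1, by omega⟩
      rw [hl.1, h1, hl.2] at h2
      simp [nearestVec] at h2
      rcases h2 with h2 | h2
      · exact h2
      · exact absurd h2 hb.ne'
    subst hjj
    obtain ⟨z, hz⟩ := (hj' (τ i)).1 ((hτ i).2 hi)
    rw [hs] at hz
    simp only [nearestVec, hi, if_true] at hz
    rw [abs_le] at hj
    have hD := abs_le.1 <| abs_engelCum_sub_le' hd hA (s := p / 2) (t := (p + j') / 2)
      (by omega) (by omega) i
    have hD' := abs_le.1 <| abs_engelCum_sub_le' hd hA (s := p / 2) (t := (p + j') / 2)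
      (by omega) (by omega) (τ i)
    set D := engelCum d A ((p + j') / 2) i - engelCum d A (p / 2) i
    set D' := engelCum d A ((p + j') / 2) (τ i) - engelCum d A (p / 2) (τ i)
    have hz' : 2 * a * z = δ * (((s i : ℤ) : ℝ) * D - D') := by linarith
    have hbound : |((s i : ℤ) : ℝ) * D - D'| ≤ 2 := by
      rw [abs_le]
      rcases hsign i with h | h <;> rw [h] <;> constructor <;> linarith
    have hz1 : |(z : ℝ)| < 1 := by
      have h1 := congrArg abs hz'
      rw [abs_mul (2 * a), abs_mul δ, abs_of_pos hδ, abs_of_pos (by positivity : 0 < 2 * a)] at h1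
      by_contra! hc
      nlinarith
    obtain rfl : z = 0 := Int.abs_lt_one_iff.1 (by exact_mod_cast hz1)
    rw [Int.cast_zero, mul_zero, eq_comm, mul_eq_zero] at hz'
    linarith [hz'.resolve_left hδ.ne']
  have hfix : ∀ i, ¬ EngelUnused d A p k i → τ i = i ∧ s i = 1 := by
    intro i hi
    by_cases hid : (i : ℕ) < d - 1
    swap
    · exact hlast i (by omega)
    simp only [EngelUnused, hid, true_and] at hi
    push Not at hi
    obtain ⟨m, hm, hmi⟩ := hi
    rw [Finset.mem_Ioc] at hm
    have h1 := hcum (2 * m - p) (by rw [abs_le]; omega) i hid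
    have h2 := hcum (2 * m - 1 - p) (by rw [abs_le]; omega) i hid
    rw [show (p + (2 * m - p)) / 2 = m by omega] at h1
    rw [show (p + (2 * m - 1 - p)) / 2 = m - 1 by omega] at h2
    have hU : ∀ l, engelCum d A m l = engelCum d A (m - 1) l + engelU d A m l := by
      intro l
      have := engelCum_add_one d A (m - 1)
      rw [sub_add_cancel] at this
      rw [this, PiLp.add_apply]
    rw [hU, hU] at h1
    have h3 : ((s i : ℤ) : ℝ) * engelU d A m i = engelU d A m (τ i) := by linarith
    rw [engelU_apply hA, engelU_apply hA, if_pos hmi.symm, hmi] at h3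
    have hne : engelSign A m ≠ 0 := by
      rcases engelSign_eq A m with h | h <;> simp [h]
    split_ifs at h3 with h4
    · refine ⟨Fin.ext (by omega), ?_⟩
      have := mul_right_cancel₀ hne (h3.trans (one_mul _).symm)
      exact Units.ext (Int.cast_injective (this.trans Int.cast_one.symm))
    · simp [hne] at h3
  refine ⟨fun i => s (τ⁻¹ i), τ, fun i hi => ⟨?_, (hfix i hi).1⟩, ?_⟩
  · have : τ⁻¹ i = i := by rw [Equiv.Perm.inv_eq_iff_eq, (hfix i hi).1]
    simp only [this, (hfix i hi).2]
  · refine IsometryEquiv.ext fun y => ?_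
    obtain ⟨v, rfl⟩ : ∃ v, x + v = y := ⟨y - x, by abel⟩
    rw [hgT, signedPerm_add_apply]
    congr 1
    ext i
    have := hs v (τ⁻¹ i)
    rwa [show τ (τ⁻¹ i) = i from τ.apply_symm_apply i] at this

end Cluster

/-- Theorem 5.5: for `0 < δ < a < b`, `k ≥ 1` and `2kR < 2b(k+1)`
(in particular whenever `a² < 2b²/(k(d-1))`), the cluster group `S_x(2kR)` of an Engel
set at a point `x` of any layer `X_p` is the full symmetry group
`C₂^{d-k-1} ⋊ S_{d-k-1}` of a `(d-k-1)`-crosspolytope if `1 ≤ k ≤ d-2`, and is trivial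
if `k ≥ d-1`. -/
theorem engel_clusterGroup (d : ℕ) (hd : 2 ≤ d) (A : ℤ → ℤ) (hA : EngelSeq d A)
    (a b δ : ℝ) (hδ : 0 < δ) (hδa : δ < a) (hab : a < b)
    (R : ℝ) (hR : R = Real.sqrt (b ^ 2 + ((d : ℝ) - 1) * a ^ 2))
    (k : ℕ) (hk : 1 ≤ k)
    (hkR : 2 * (k : ℝ) * R < 2 * b * ((k : ℝ) + 1) ∨
      a ^ 2 < 2 * b ^ 2 / ((k : ℝ) * ((d : ℝ) - 1)))
    (p : ℤ) (x : Euc d) (hx : x ∈ engelLayer d A a b δ p) :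
    (k ≤ d - 2 →
      Nonempty (clusterGroup (engelSet d A a b δ) x (2 * (k : ℝ) * R) ≃*
        hyperoctahedralGroup (d - k - 1))) ∧
    (d - 1 ≤ k → clusterGroup (engelSet d A a b δ) x (2 * (k : ℝ) * R) = ⊥) := by
  have hb : 0 < b := (hδ.trans hδa).trans hab
  have hk1 : (1 : ℝ) ≤ k := by exact_mod_cast hk
  have hd1 : (1 : ℝ) ≤ (d : ℝ) - 1 := by
    have : (2 : ℝ) ≤ d := by exact_mod_cast hd
    linarith
  have hR0 : 0 ≤ R := hR ▸ Real.sqrt_nonneg _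
  have hR2 : R ^ 2 = b ^ 2 + ((d : ℝ) - 1) * a ^ 2 := by
    rw [hR, Real.sq_sqrt (by positivity)]
  have hup : 2 * (k : ℝ) * R < 2 * b * ((k : ℝ) + 1) := by
    rcases hkR with h | h
    · exact h
    · rw [lt_div_iff₀ (by positivity)] at h
      refine lt_of_pow_lt_pow_left₀ 2 (by positivity) ?_
      have h1 : k * (a ^ 2 * (k * ((d : ℝ) - 1))) < k * (2 * b ^ 2) := by gcongr
      have h2 : 0 < b ^ 2 := by positivity
      calc (2 * (k : ℝ) * R) ^ 2 = 4 * k ^ 2 * b ^ 2 + 4 * (k * (a ^ 2 * (k * ((d : ℝ) - 1)))) := by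
            rw [mul_pow, hR2]
            ring
        _ < (2 * b * ((k : ℝ) + 1)) ^ 2 := by nlinarith
  have hρ : ∀ k' : ℕ, k' ≤ k →
      (2 * b * k') ^ 2 + ((d : ℝ) - 1) * a ^ 2 ≤ (2 * (k : ℝ) * R) ^ 2 := by
    intro k' hk'
    have h0 : (k' : ℝ) ≤ k := by exact_mod_cast hk'
    have h1 : (2 * b * k') ^ 2 ≤ (2 * b * k) ^ 2 := by gcongr
    have h2 : 0 ≤ ((d : ℝ) - 1) * a ^ 2 := by positivity
    have h3 : (1 : ℝ) ≤ 4 * k ^ 2 := by nlinarith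
    calc (2 * b * k') ^ 2 + ((d : ℝ) - 1) * a ^ 2
        ≤ (2 * b * k) ^ 2 + (4 * k ^ 2) * (((d : ℝ) - 1) * a ^ 2) := by nlinarith
      _ = (2 * (k : ℝ) * R) ^ 2 := by
        rw [mul_pow _ R, hR2]
        ring
  refine ⟨fun hkd => ?_, fun hkd => ?_⟩
  · have e : Fin (d - k - 1) ≃ Subtype (EngelUnused d A p k) :=
      (Finite.equivFinOfCardEq (card_engelUnused hd hA p (by omega))).symm
    have heq : clusterGroup (engelSet d A a b δ) x (2 * (k : ℝ) * R) =
        (hyperoctahedralHom e x).range := by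
      ext g
      rw [mem_range_hyperoctahedralHom]
      exact ⟨isSignedPermOn_of_mem_clusterGroup hd hA hδ hδa hab hx hk (by omega) (by positivity)
        (hρ k le_rfl), fun hg => hg.mem_clusterGroup hd hA hb hx hup⟩
    rw [heq]
    exact ⟨(MonoidHom.ofInjective (hyperoctahedralHom_injective e x)).symm⟩
  · refine (Subgroup.eq_bot_iff_forall _).2 fun g hg => ?_
    obtain ⟨s, τ, h, rfl⟩ := isSignedPermOn_of_mem_clusterGroup hd hA hδ hδa hab hx
      (k := d - 1) (by omega) le_rfl (by positivity) (hρ _ hkd) hg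
    have hempty : ∀ i, ¬ EngelUnused d A p (d - 1) i := by
      intro i hi
      have hc := card_engelUnused hd hA p (le_refl (d - 1))
      rw [show d - (d - 1) - 1 = 0 by omega, Finite.card_eq_zero_iff] at hc
      exact hc.false ⟨i, hi⟩
    rw [← signedPerm_one x]
    exact signedPerm_inj.2 ⟨funext fun i => (h i (hempty i)).1,
      Equiv.ext fun i => (h i (hempty i)).2⟩
end
end

section
/- Let d ≥ 2 and 0 < δ < a < b. The Engel set X(A,a,b,δ) is a regular system if and only if either a_{i+d−1} = aᵢ for all i ∈ ℤ or a_{i+d−1} = −aᵢ for all i ∈ ℤ. -/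
noncomputable section
open scoped Pointwise

section EngelSymmetries

open Module

variable {n : ℕ} {A : ℤ → ℤ} {a b δ : ℝ}

lemma engelCum_succ (d : ℕ) (A : ℤ → ℤ) (i : ℤ) :
    engelCum d A (i + 1) = engelCum d A i + engelU d A (i + 1) := by
  rcases le_or_gt 0 i with hi | hi
  · lift i to ℕ using hi
    have h : (0 : ℤ) ≤ (i : ℤ) + 1 := by positivity
    have h2 : ((i : ℤ) + 1).toNat = i + 1 := by omega
    simp [engelCum, h, h2, Finset.sum_range_succ]
  · obtain ⟨k, rfl⟩ : ∃ k : ℕ, i = -((k : ℤ) + 1) := ⟨(-i - 1).toNat, by omega⟩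
    have h1 : ¬ (0 : ℤ) ≤ -((k : ℤ) + 1) := by omega
    have h2 : (-(-((k : ℤ) + 1))).toNat = k + 1 := by omega
    have h3 : -((k : ℤ) + 1) + 1 = -(k : ℤ) := by ring
    rw [h3]
    unfold engelCum
    rw [if_neg h1, h2, Finset.sum_range_succ]
    rcases Nat.eq_zero_or_pos k with rfl | hk
    · simp
    · rw [if_neg (by omega), neg_neg, Int.toNat_natCast]
      abel

lemma eVec_last : eVec (n + 1) (n + 1) = EuclideanSpace.single (Fin.last n) (1 : ℝ) := by
  simp [eVec, Fin.last]

lemma engelU_eq_single (hA : EngelSeq (n + 1) A) (i : ℤ) :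
    ∃ j : Fin n, (j : ℕ) + 1 = (A i).natAbs ∧ engelU (n + 1) A i =
      (if 0 < A i then (1 : ℝ) else -1) • EuclideanSpace.single j.castSucc (1 : ℝ) := by
  have h := hA.1 i
  simp only [Nat.add_sub_cancel] at h
  refine ⟨⟨(A i).natAbs - 1, by omega⟩, by simp; omega, ?_⟩
  have h1 : (A i).natAbs - 1 < n + 1 := by omega
  simp [engelU, eVec, h1]

lemma engelU_apply_last (hA : EngelSeq (n + 1) A) (i : ℤ) :
    engelU (n + 1) A i (Fin.last n) = 0 := by
  obtain ⟨j, -, h⟩ := engelU_eq_single hA i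
  rw [h, PiLp.smul_apply]
  simp

lemma norm_engelU (hA : EngelSeq (n + 1) A) (i : ℤ) : ‖engelU (n + 1) A i‖ = 1 := by
  obtain ⟨j, -, h⟩ := engelU_eq_single hA i
  rw [h, norm_smul]
  split_ifs <;> simp

lemma engelU_ne_zero (hA : EngelSeq (n + 1) A) (i : ℤ) : engelU (n + 1) A i ≠ 0 := by
  rw [← norm_ne_zero_iff, norm_engelU hA]
  exact one_ne_zero

lemma engelU_congr {i j : ℤ} (h : A i = A j) (d : ℕ) : engelU d A i = engelU d A j := by
  simp [engelU, h]

lemma engelU_eq_neg (hA : EngelSeq (n + 1) A) {i j : ℤ} (h : A i = -A j) :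
    engelU (n + 1) A i = -engelU (n + 1) A j := by
  have hj := (hA.1 j).1
  simp only [engelU, h, Int.natAbs_neg]
  rcases lt_or_gt_of_ne (show A j ≠ 0 by omega) with h0 | h0
  · rw [if_pos (by omega), if_neg (by omega)]; simp
  · rw [if_neg (by omega), if_pos (by omega)]; simp

lemma EngelSeq.periodic_natAbs (hA : EngelSeq (n + 1) A) :
    Function.Periodic (fun i => (A i).natAbs) (n : ℤ) := by
  intro i
  simpa using hA.2.1 i

lemma EngelSeq.exists_natAbs_eq (hA : EngelSeq (n + 1) A) (j : Fin n) :
    ∃ i : ℤ, 1 ≤ i ∧ i ≤ n ∧ (A i).natAbs = j + 1 := by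
  simpa using hA.2.2 (j + 1) (by omega) (by simp)

lemma EngelSeq.dvd_sub_of_natAbs_eq (hA : EngelSeq (n + 1) A) {i j : ℤ}
    (h : (A i).natAbs = (A j).natAbs) : (n : ℤ) ∣ i - j := by
  have hbd : ∀ k : ℤ, (A k).natAbs - 1 < n := fun k => by
    have := hA.1 k
    simp only [Nat.add_sub_cancel] at this
    omega
  let f : Fin n → Fin n := fun k => ⟨(A (k + 1)).natAbs - 1, hbd _⟩
  have hf : Function.Surjective f := by
    intro k
    obtain ⟨i, h1, h2, h3⟩ := hA.exists_natAbs_eq k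
    refine ⟨⟨(i - 1).toNat, by omega⟩, ?_⟩
    have : ((i - 1).toNat : ℤ) + 1 = i := by omega
    ext
    simp only [f, this, h3, Nat.add_sub_cancel]
  have hinj := Finite.injective_iff_surjective.2 hf
  have hn : (0 : ℤ) < n := by
    have := hbd 0
    omega
  have hred : ∀ i : ℤ, (A i).natAbs = (A ((i - 1) % n + 1)).natAbs := by
    intro i
    have h1 := hA.periodic_natAbs.int_mul ((i - 1) / n) ((i - 1) % n + 1)
    have h2 : (i - 1) % n + 1 + ((i - 1) / n : ℤ) * (n : ℤ) = i := by
      have := Int.emod_add_mul_ediv (i - 1) n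
      linarith
    simp only [Int.cast_id, h2] at h1
    exact h1
  have hlt : ∀ i : ℤ, ((i - 1) % n).toNat < n := fun i => by
    have h1 := Int.emod_nonneg (i - 1) hn.ne'
    have h2 := Int.emod_lt_of_pos (i - 1) hn
    omega
  have hcast : ∀ i : ℤ, (((i - 1) % n).toNat : ℤ) = (i - 1) % n := fun i =>
    Int.toNat_of_nonneg (Int.emod_nonneg (i - 1) hn.ne')
  have heq : f ⟨_, hlt i⟩ = f ⟨_, hlt j⟩ := by
    ext
    simp only [f, hcast, ← hred, h]
  have h3 := hinj heq
  simp only [Fin.mk.injEq] at h3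
  have h4 : (i - 1) % n = (j - 1) % n := by rw [← hcast i, ← hcast j, h3]
  have h5 := Int.ModEq.dvd (n := n) h4.symm
  simpa using h5

lemma inner_engelU (hA : EngelSeq (n + 1) A) {i j : ℤ} (h : ¬ (n : ℤ) ∣ i - j) :
    inner ℝ (engelU (n + 1) A i) (engelU (n + 1) A j) = 0 := by
  obtain ⟨k, hk, hi⟩ := engelU_eq_single hA i
  obtain ⟨l, hl, hj⟩ := engelU_eq_single hA j
  have hkl : l ≠ k := by
    rintro rfl
    exact h (hA.dvd_sub_of_natAbs_eq (by omega))
  rw [hi, hj, real_inner_smul_left, real_inner_smul_right]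
  simp [EuclideanSpace.inner_single_left, hkl.symm]

lemma inner_engelU_eVec_last (hA : EngelSeq (n + 1) A) (i : ℤ) :
    inner ℝ (engelU (n + 1) A i) (eVec (n + 1) (n + 1)) = 0 := by
  simp [eVec_last, EuclideanSpace.inner_single_right, engelU_apply_last hA]

/-- The grid `2aℤ^n × {0}` as an additive subgroup. -/
def engelGridSubgroup (n : ℕ) (a : ℝ) : AddSubgroup (Euc (n + 1)) where
  carrier := engelGrid (n + 1) a
  zero_mem' := fun j => ⟨fun _ => ⟨0, by simp⟩, fun _ => by simp⟩
  add_mem' := by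
    intro x y hx hy j
    refine ⟨fun h => ?_, fun h => ?_⟩
    · obtain ⟨k, hk⟩ := (hx j).1 h
      obtain ⟨l, hl⟩ := (hy j).1 h
      exact ⟨k + l, by simp [hk, hl]; ring⟩
    · simp [(hx j).2 h, (hy j).2 h]
  neg_mem' := by
    intro x hx j
    refine ⟨fun h => ?_, fun h => ?_⟩
    · obtain ⟨k, hk⟩ := (hx j).1 h
      exact ⟨-k, by simp [hk]⟩
    · simp [(hx j).2 h]

lemma mem_engelGridSubgroup {x : Euc (n + 1)} : x ∈ engelGridSubgroup n a ↔
    (∀ j : Fin n, ∃ m : ℤ, x j.castSucc = 2 * a * m) ∧ x (Fin.last n) = 0 := by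
  change (∀ j : Fin (n + 1), _) ↔ _
  rw [Fin.forall_fin_succ']
  simp [(Fin.is_lt _).ne]

lemma single_eq_smul_single_one (j : Fin n) (c : ℝ) :
    EuclideanSpace.single j c = c • EuclideanSpace.single j (1 : ℝ) := by
  ext k
  by_cases h : k = j <;> simp [h]

lemma single_mem_engelGridSubgroup (a : ℝ) (j : Fin n) (m : ℤ) :
    EuclideanSpace.single j.castSucc (2 * a * m) ∈ engelGridSubgroup n a := by
  rw [mem_engelGridSubgroup]
  refine ⟨fun k => ?_, by simp [(Fin.castSucc_lt_last j).ne']⟩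
  by_cases h : k = j
  · exact ⟨m, by simp [h]⟩
  · exact ⟨0, by simp [h]⟩

lemma smul_engelU_mem (hA : EngelSeq (n + 1) A) (a : ℝ) (m i : ℤ) :
    (2 * a * m) • engelU (n + 1) A i ∈ engelGridSubgroup n a := by
  obtain ⟨j, -, h⟩ := engelU_eq_single hA i
  have h2 := single_mem_engelGridSubgroup a j m
  rw [single_eq_smul_single_one] at h2
  rw [h]
  split_ifs
  · simpa using h2
  · simpa using neg_mem h2

lemma mem_engelSet {x : Euc (n + 1)} : x ∈ engelSet (n + 1) A a b δ ↔
    ∃ m : ℤ, x - engelOffset (n + 1) A b δ m ∈ engelGridSubgroup n a := by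
  simp only [engelSet, engelLayer, Set.mem_iUnion, Set.mem_vadd_set]
  refine exists_congr fun m => ⟨?_, fun h => ⟨_, h, by simp⟩⟩
  rintro ⟨y, hy, rfl⟩
  rwa [vadd_eq_add, add_sub_cancel_left]

lemma exists_engelU_eq (hA : EngelSeq (n + 1) A) (j : Fin n) :
    ∃ i : ℤ, EuclideanSpace.single j.castSucc (1 : ℝ) = engelU (n + 1) A i ∨
      EuclideanSpace.single j.castSucc (1 : ℝ) = -engelU (n + 1) A i := by
  obtain ⟨i, -, -, h⟩ := hA.exists_natAbs_eq j
  refine ⟨i, ?_⟩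
  obtain ⟨k, hk, hi⟩ := engelU_eq_single hA i
  obtain rfl : k = j := by ext; omega
  rw [hi]
  split_ifs <;> simp

lemma map_mem_engelGridSubgroup (hA : EngelSeq (n + 1) A) (L : Euc (n + 1) →ₗ[ℝ] Euc (n + 1))
    (hL : ∀ i, ∃ k, L (engelU (n + 1) A i) = engelU (n + 1) A k ∨
      L (engelU (n + 1) A i) = -engelU (n + 1) A k)
    {x : Euc (n + 1)} (hx : x ∈ engelGridSubgroup n a) : L x ∈ engelGridSubgroup n a := by
  obtain ⟨hx1, hx2⟩ := mem_engelGridSubgroup.1 hx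
  have hsum := (EuclideanSpace.basisFun (Fin (n + 1)) ℝ).sum_repr x
  rw [← hsum, map_sum]
  refine sum_mem fun j _ => ?_
  simp only [EuclideanSpace.basisFun_repr, EuclideanSpace.basisFun_apply, map_smul]
  refine Fin.lastCases ?_ (fun j => ?_) j
  · simp [hx2, zero_mem]
  · obtain ⟨m, hm⟩ := hx1 j
    obtain ⟨i, hi⟩ := exists_engelU_eq hA j
    obtain ⟨k, hk⟩ := hL i
    have h := smul_engelU_mem hA a m k
    rw [hm]
    rcases hi with hi | hi <;> rcases hk with hk | hk <;> simp only [hi, hk, map_neg, neg_neg, smul_neg]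
    all_goals first | exact h | exact neg_mem h

lemma engelSet_exists_isometry {m : ℤ} (L : Euc (n + 1) ≃ₗᵢ[ℝ] Euc (n + 1)) (τ : ℤ ≃ ℤ)
    (hL : ∀ x, L x ∈ engelGridSubgroup n a ↔ x ∈ engelGridSubgroup n a) (c : Euc (n + 1))
    (hoff : ∀ t, engelOffset (n + 1) A b δ (τ t) = L (engelOffset (n + 1) A b δ t) + c)
    {x y : Euc (n + 1)} (hx : x - engelOffset (n + 1) A b δ m ∈ engelGridSubgroup n a)
    (hy : y - engelOffset (n + 1) A b δ (τ m) ∈ engelGridSubgroup n a) :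
    ∃ g : Euc (n + 1) ≃ᵢ Euc (n + 1),
      g '' engelSet (n + 1) A a b δ = engelSet (n + 1) A a b δ ∧ g x = y := by
  let g : Euc (n + 1) ≃ᵢ Euc (n + 1) := L.toIsometryEquiv.trans (IsometryEquiv.addRight (y - L x))
  have hg : ∀ z, g z = L z + (y - L x) := fun z => rfl
  have hiff : ∀ z, g z ∈ engelSet (n + 1) A a b δ ↔ z ∈ engelSet (n + 1) A a b δ := by
    intro z
    rw [mem_engelSet, mem_engelSet, ← τ.exists_congr_right]
    refine exists_congr fun t => ?_
    rw [← hL (z - _)]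
    have h : g z - engelOffset (n + 1) A b δ (τ t) =
        L (z - engelOffset (n + 1) A b δ t) + ((y - engelOffset (n + 1) A b δ (τ m)) -
          L (x - engelOffset (n + 1) A b δ m)) := by
      rw [hg, hoff, hoff, map_sub, map_sub]
      abel
    rw [h]
    exact AddSubgroup.add_mem_cancel_right _ (sub_mem hy ((hL _).2 hx))
  refine ⟨g, ?_, by simp [hg]⟩
  ext z
  constructor
  · rintro ⟨w, hw, rfl⟩
    exact (hiff w).2 hw
  · intro hz
    exact ⟨g.symm z, (hiff _).1 (by simpa using hz), by simp⟩

lemma orthonormal_engelU (hA : EngelSeq (n + 1) A) (σ : ℤ) (hσ : σ = 1 ∨ σ = -1) (k : ℤ) :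
    Orthonormal ℝ (Fin.snoc (α := fun _ => Euc (n + 1))
      (fun j : Fin n => (σ : ℝ) • engelU (n + 1) A (σ * j + k))
      ((σ : ℝ) • eVec (n + 1) (n + 1))) := by
  have hσ' : ‖(σ : ℝ)‖ = 1 := by rcases hσ with rfl | rfl <;> simp
  constructor
  · intro i
    refine Fin.lastCases ?_ (fun j => ?_) i
    · simp [norm_smul, hσ', eVec_last]
    · simp [norm_smul, hσ', norm_engelU hA]
  · intro i j hij
    induction i using Fin.lastCases with
    | last =>
      induction j using Fin.lastCases with
      | last => exact absurd rfl hij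
      | cast j =>
        simp [real_inner_smul_left, real_inner_smul_right, real_inner_comm _ (eVec _ _),
          inner_engelU_eVec_last hA]
    | cast i =>
      induction j using Fin.lastCases with
      | last =>
        simp [real_inner_smul_left, real_inner_smul_right, inner_engelU_eVec_last hA]
      | cast j =>
        have h : ¬ (n : ℤ) ∣ (σ * i + k) - (σ * j + k) := by
          intro h
          have h1 : (n : ℤ) ∣ (i : ℤ) - j := by
            rcases hσ with rfl | rfl
            · simpa using h
            · obtain ⟨q, hq⟩ := h
              exact ⟨-q, by linarith⟩
          have h2 := Int.eq_zero_of_abs_lt_dvd h1 (by rw [abs_lt]; omega)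
          exact hij (congrArg _ (Fin.ext (by omega)))
        simp [real_inner_smul_left, real_inner_smul_right, inner_engelU hA h]

lemma Orthonormal.exists_linearIsometryEquiv {v w : Fin (n + 1) → Euc (n + 1)}
    (hv : Orthonormal ℝ v) (hw : Orthonormal ℝ w) :
    ∃ L : Euc (n + 1) ≃ₗᵢ[ℝ] Euc (n + 1), ∀ i, L (v i) = w i := by
  have hc : Fintype.card (Fin (n + 1)) = finrank ℝ (Euc (n + 1)) := by simp
  have hv' := coe_basisOfOrthonormalOfCardEqFinrank hv hc
  have hw' := coe_basisOfOrthonormalOfCardEqFinrank hw hc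
  let B := (basisOfOrthonormalOfCardEqFinrank hv hc).toOrthonormalBasis (by rwa [hv'])
  let C := (basisOfOrthonormalOfCardEqFinrank hw hc).toOrthonormalBasis (by rwa [hw'])
  have hB : ∀ i, B i = v i := fun i => by simp [B]
  have hC : ∀ i, C i = w i := fun i => by simp [C]
  exact ⟨B.equiv C (Equiv.refl _), fun i => by rw [← hB, ← hC]; simp⟩

lemma exists_linearIsometryEquiv_engelU (hn : 0 < n) (hA : EngelSeq (n + 1) A) {s : ℝ}
    (hs : s * s = 1) (hper : ∀ i, engelU (n + 1) A (i + n) = s • engelU (n + 1) A i)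
    (σ : ℤ) (hσ : σ = 1 ∨ σ = -1) (k : ℤ) :
    ∃ L : Euc (n + 1) ≃ₗᵢ[ℝ] Euc (n + 1),
      L (eVec (n + 1) (n + 1)) = (σ : ℝ) • eVec (n + 1) (n + 1) ∧
      ∀ i, L (engelU (n + 1) A i) = (σ : ℝ) • engelU (n + 1) A (σ * i + k) := by
  obtain ⟨L, hL⟩ := (orthonormal_engelU hA 1 (Or.inl rfl) 0).exists_linearIsometryEquiv
    (orthonormal_engelU hA σ hσ k)
  refine ⟨L, by simpa using hL (Fin.last n), ?_⟩
  have hper' : ∀ i, engelU (n + 1) A (i - n) = s • engelU (n + 1) A i := by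
    intro i
    have h := hper (i - n)
    rw [sub_add_cancel] at h
    rw [h, smul_smul, hs, one_smul]
  have hperσ : ∀ i, engelU (n + 1) A (i + σ * n) = s • engelU (n + 1) A i := by
    intro i
    rcases hσ with rfl | rfl
    · simpa using hper i
    · simpa [sub_eq_add_neg] using hper' i
  have hperσ' : ∀ i, engelU (n + 1) A (i - σ * n) = s • engelU (n + 1) A i := by
    intro i
    rcases hσ with rfl | rfl
    · simpa using hper' i
    · simpa using hper i
  have key : ∀ (j : Fin n) (q : ℤ), L (engelU (n + 1) A (j + q * n)) =
      (σ : ℝ) • engelU (n + 1) A (σ * (j + q * n) + k) := by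
    intro j q
    induction q using Int.induction_on with
    | zero => simpa using hL j.castSucc
    | succ q ih =>
      have h1 : (j : ℤ) + (q + 1) * n = j + q * n + n := by ring
      have h2 : σ * ((j : ℤ) + q * n + n) + k = σ * (j + q * n) + k + σ * n := by ring
      rw [h1, h2, hper, map_smul, ih, hperσ, smul_comm]
    | pred q ih =>
      have h1 : (j : ℤ) + (-q - 1) * n = j + -q * n - n := by ring
      have h2 : σ * ((j : ℤ) + -q * n - n) + k = σ * (j + -q * n) + k - σ * n := by ring
      rw [h1, h2, hper', map_smul, ih, hperσ', smul_comm]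
  intro i
  have hn' : (0 : ℤ) < n := by exact_mod_cast hn
  have h1 := Int.emod_nonneg i hn'.ne'
  have h2 := Int.emod_lt_of_pos i hn'
  have h3 := key ⟨(i % n).toNat, by omega⟩ (i / n)
  have h4 : ((i % n).toNat : ℤ) + i / n * n = i := by
    rw [Int.toNat_of_nonneg h1]
    linarith [Int.emod_add_mul_ediv i n]
  simpa only [h4] using h3

lemma isRegularSystem_engelSet (hn : 0 < n) (hA : EngelSeq (n + 1) A) {s : ℝ}
    (hs : s * s = 1) (hper : ∀ i, engelU (n + 1) A (i + n) = s • engelU (n + 1) A i) :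
    IsRegularSystem (engelSet (n + 1) A a b δ) := by
  intro x hx y hy
  obtain ⟨m, hx⟩ := mem_engelSet.1 hx
  obtain ⟨m', hy⟩ := mem_engelSet.1 hy
  obtain ⟨σ, k, τ, hσ, hτm, hτ, c, hτc⟩ : ∃ (σ k : ℤ) (τ : ℤ ≃ ℤ), (σ = 1 ∨ σ = -1) ∧ τ m = m' ∧
      (∀ t, τ t / 2 = σ * (t / 2) + k) ∧ ∃ c : ℤ, ∀ t, τ t = σ * t + c := by
    rcases Int.even_or_odd' (m' - m) with ⟨k, hk | hk⟩
    · refine ⟨1, k, Equiv.addRight (2 * k), Or.inl rfl, ?_, fun t => ?_, 2 * k, fun t => ?_⟩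
      · simp only [Equiv.coe_addRight]; omega
      · simp only [Equiv.coe_addRight]; omega
      · simp
    · refine ⟨-1, k + m, Equiv.subLeft (m + m'), Or.inr rfl, ?_, fun t => ?_, m + m', fun t => ?_⟩
      · simp
      · simp only [Equiv.subLeft_apply]; omega
      · simp only [Equiv.subLeft_apply]; ring
  have hσσ : (σ : ℝ) * σ = 1 := by rcases hσ with rfl | rfl <;> simp
  have hσσ' : σ * σ = 1 := by rcases hσ with rfl | rfl <;> simp
  -- the shift is chosen so that increments of `engelCum` correspond
  obtain ⟨k', hk'⟩ : ∃ k' : ℤ, ∀ i, engelCum (n + 1) A (σ * (i + 1) + k) =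
      engelCum (n + 1) A (σ * i + k) + (σ : ℝ) • engelU (n + 1) A (σ * (i + 1) + k') := by
    rcases hσ with rfl | rfl
    · refine ⟨k, fun i => ?_⟩
      have := engelCum_succ (n + 1) A (1 * i + k)
      rw [show 1 * (i + 1) + k = 1 * i + k + 1 by ring, this]
      simp
    · refine ⟨k + 1, fun i => ?_⟩
      have := engelCum_succ (n + 1) A (-1 * (i + 1) + k)
      rw [show -1 * i + k = -1 * (i + 1) + k + 1 by ring, this,
        show -1 * (i + 1) + (k + 1) = -1 * (i + 1) + k + 1 by ring]
      simp
  obtain ⟨L, hLe, hLu⟩ := exists_linearIsometryEquiv_engelU hn hA hs hper σ hσ k'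
  have hsymm : ∀ i, L.symm (engelU (n + 1) A i) =
      (σ : ℝ) • engelU (n + 1) A (σ * (i - k')) := by
    intro i
    rw [LinearIsometryEquiv.symm_apply_eq, map_smul, hLu, smul_smul, hσσ, one_smul, ← mul_assoc,
      hσσ', one_mul, sub_add_cancel]
  have hsmul : ∀ v : Euc (n + 1), (σ : ℝ) • v = v ∨ (σ : ℝ) • v = -v := by
    intro v
    rcases hσ with rfl | rfl <;> simp
  have hL : ∀ x, L x ∈ engelGridSubgroup n a ↔ x ∈ engelGridSubgroup n a := by
    refine fun x => ⟨fun h => ?_, fun h => ?_⟩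
    · have := map_mem_engelGridSubgroup hA L.symm.toLinearEquiv.toLinearMap
        (fun i => ⟨_, by simpa [hsymm] using hsmul _⟩) h
      simpa using this
    · exact map_mem_engelGridSubgroup hA L.toLinearEquiv.toLinearMap
        (fun i => ⟨_, by simpa [hLu] using hsmul _⟩) h
  have hcum : ∀ i, engelCum (n + 1) A (σ * i + k) =
      L (engelCum (n + 1) A i) + engelCum (n + 1) A k := by
    intro i
    induction i using Int.induction_on with
    | zero => simp [engelCum]
    | succ i ih =>
      rw [hk', ih, engelCum_succ, map_add, hLu]
      abel
    | pred i ih =>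
      have h1 := hk' (-i - 1)
      have h2 := engelCum_succ (n + 1) A (-i - 1)
      rw [sub_add_cancel] at h1 h2
      rw [ih, h2, map_add, hLu] at h1
      have h3 := sub_eq_iff_eq_add.2 h1
      rw [← h3]
      abel
  subst hτm
  refine engelSet_exists_isometry L τ hL ((2 * b * c) • eVec (n + 1) (n + 1) +
    δ • engelCum (n + 1) A k) (fun t => ?_) hx hy
  rw [engelOffset, engelOffset, hτ, hcum, hτc, map_add, map_smul, map_smul, hLe]
  push_cast
  module

lemma engelOffset_apply_last (hA : EngelSeq (n + 1) A) (b δ : ℝ) (m : ℤ) :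
    engelOffset (n + 1) A b δ m (Fin.last n) = 2 * b * m := by
  have h : ∀ i, engelCum (n + 1) A i (Fin.last n) = 0 := by
    intro i
    unfold engelCum
    split_ifs <;> simp [engelU_apply_last hA]
  simp [engelOffset, h, eVec_last]

lemma sub_engelOffset_mem (hA : EngelSeq (n + 1) A) (hb : 0 < b) {x : Euc (n + 1)}
    (hx : x ∈ engelSet (n + 1) A a b δ) {m : ℤ} (hm : x (Fin.last n) = 2 * b * m) :
    x - engelOffset (n + 1) A b δ m ∈ engelGridSubgroup n a := by
  obtain ⟨m', h⟩ := mem_engelSet.1 hx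
  have h1 := (mem_engelGridSubgroup.1 h).2
  rw [PiLp.sub_apply, engelOffset_apply_last hA, hm, ← mul_sub] at h1
  have h2 : (m : ℝ) - m' = 0 := by
    rcases mul_eq_zero.1 h1 with h | h
    · linarith
    · exact h
  obtain rfl : m = m' := by exact_mod_cast sub_eq_zero.1 h2
  exact h

/-- The linear part of a symmetry of an Engel set preserves the horizontal hyperplane. -/
lemma linearIsometry_apply_last_eq_zero (hA : EngelSeq (n + 1) A) (ha : 0 < a) (hab : a < b)
    {f : Euc (n + 1) → Euc (n + 1)}
    (hf : ∀ x ∈ engelSet (n + 1) A a b δ, f x ∈ engelSet (n + 1) A a b δ)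
    (L : Euc (n + 1) ≃ₗᵢ[ℝ] Euc (n + 1)) (hL : ∀ x y, L (x - y) = f x - f y) (j : Fin n) :
    L (EuclideanSpace.single j.castSucc 1) (Fin.last n) = 0 := by
  have hmem : ∀ v ∈ engelGridSubgroup n a,
      engelOffset (n + 1) A b δ 0 + v ∈ engelSet (n + 1) A a b δ := fun v hv =>
    mem_engelSet.2 ⟨0, by simpa using hv⟩
  have hs : EuclideanSpace.single j.castSucc (2 * a) ∈ engelGridSubgroup n a := by
    simpa using single_mem_engelGridSubgroup a j 1
  obtain ⟨m, hm⟩ := mem_engelSet.1 (hf _ (hmem 0 (zero_mem _)))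
  obtain ⟨m', hm'⟩ := mem_engelSet.1 (hf _ (hmem _ hs))
  have hm := (mem_engelGridSubgroup.1 hm).2
  have hm' := (mem_engelGridSubgroup.1 hm').2
  rw [PiLp.sub_apply, engelOffset_apply_last hA] at hm hm'
  have h1 := hL (engelOffset (n + 1) A b δ 0 + EuclideanSpace.single j.castSucc (2 * a))
    (engelOffset (n + 1) A b δ 0 + 0)
  rw [add_sub_add_left_eq_sub, sub_zero] at h1
  have h2 : L (EuclideanSpace.single j.castSucc (2 * a)) (Fin.last n) = 2 * b * (m' - m) := by
    rw [h1, PiLp.sub_apply]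
    linarith
  have h3 : |2 * b * ((m' : ℝ) - m)| ≤ 2 * a := by
    have := PiLp.norm_apply_le (L (EuclideanSpace.single j.castSucc (2 * a))) (Fin.last n)
    rw [h2, L.norm_map, PiLp.norm_single, Real.norm_eq_abs, Real.norm_eq_abs,
      abs_of_pos (by linarith : 0 < 2 * a)] at this
    exact this
  have h4 : m' - m = 0 := by
    rw [abs_mul, abs_of_pos (by linarith : 0 < 2 * b)] at h3
    rw [← Int.abs_lt_one_iff]
    have : |((m' - m : ℤ) : ℝ)| < 1 := by
      push_cast
      nlinarith
    exact_mod_cast this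
  have h5 : (m' : ℝ) - m = 0 := by exact_mod_cast h4
  rw [h5, single_eq_smul_single_one, map_smul] at h2
  simpa [ha.ne'] using h2

/-- An element `v` of the grid with all coordinates small vanishes. -/
lemma eq_zero_of_mem_engelGridSubgroup {v : Euc (n + 1)} (hv : v ∈ engelGridSubgroup n a)
    (h : ∀ j, |v j| < 2 * a) : v = 0 := by
  obtain ⟨h1, h2⟩ := mem_engelGridSubgroup.1 hv
  ext j
  refine Fin.lastCases (by simpa using h2) (fun j => ?_) j
  obtain ⟨m, hm⟩ := h1 j
  have h3 := h j.castSucc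
  have ha : 0 < 2 * a := (abs_nonneg _).trans_lt h3
  rw [hm, abs_mul, abs_of_pos ha] at h3
  have h4 : |(m : ℝ)| < 1 := by nlinarith
  have h5 : m = 0 := by
    rw [← Int.abs_lt_one_iff]
    exact_mod_cast h4
  simp [hm, h5]

lemma exists_linearIsometryEquiv_of_isRegularSystem (hA : EngelSeq (n + 1) A)
    (hδ : 0 < δ) (hδa : δ < a) (hab : a < b)
    (hreg : IsRegularSystem (engelSet (n + 1) A a b δ)) :
    ∃ L : Euc (n + 1) ≃ₗᵢ[ℝ] Euc (n + 1),
      ∀ i, L (engelU (n + 1) A i) = engelU (n + 1) A (i + 1) := by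
  have hb : 0 < b := by linarith
  have hoff_mem : ∀ m, engelOffset (n + 1) A b δ m ∈ engelSet (n + 1) A a b δ := fun m =>
    mem_engelSet.2 ⟨m, by simp [zero_mem]⟩
  obtain ⟨g, hg, hg0⟩ := hreg _ (hoff_mem 0) _ (hoff_mem 2)
  have hgX : ∀ x ∈ engelSet (n + 1) A a b δ, g x ∈ engelSet (n + 1) A a b δ := fun x hx =>
    hg ▸ Set.mem_image_of_mem g hx
  have hgX' : ∀ x ∈ engelSet (n + 1) A a b δ, g.symm x ∈ engelSet (n + 1) A a b δ := by
    intro x hx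
    rw [← hg] at hx
    obtain ⟨y, hy, rfl⟩ := hx
    simpa using hy
  let L := g.toRealAffineIsometryEquiv.linearIsometryEquiv
  have hL : ∀ x y, L (x - y) = g x - g y := fun x y => by
    have := g.toRealAffineIsometryEquiv.map_vsub x y
    simpa using this
  have hL' : ∀ x y, L.symm (x - y) = g.symm x - g.symm y := fun x y => by
    rw [LinearIsometryEquiv.symm_apply_eq, hL]
    simp
  set e := eVec (n + 1) (n + 1) with he
  have hlast : ∀ x : Euc (n + 1), inner ℝ x e = x (Fin.last n) := fun x => by
    simp [he, eVec_last, EuclideanSpace.inner_single_right]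
  have hLe : ∀ j : Fin n, L e j.castSucc = 0 := by
    intro j
    have h := linearIsometry_apply_last_eq_zero hA (hδ.trans hδa) hab hgX' L.symm hL' j
    rw [← hlast, ← L.inner_map_map, L.apply_symm_apply] at h
    simpa [EuclideanSpace.inner_single_left] using h
  have hLe' : L e = (L e (Fin.last n)) • e := by
    ext j
    refine Fin.lastCases ?_ (fun j => ?_) j
    · simp [he, eVec_last]
    · rw [hLe, PiLp.smul_apply]
      simp [he, eVec_last, (Fin.castSucc_lt_last j).ne]
  set σ := L e (Fin.last n) with hσ
  have hσ1 : σ = 1 ∨ σ = -1 := by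
    have h := L.norm_map e
    rw [hLe', norm_smul] at h
    have h1 : ‖e‖ = 1 := by simp [he, eVec_last]
    rw [h1, mul_one, Real.norm_eq_abs] at h
    exact eq_or_eq_neg_of_abs_eq h
  have hLlast : ∀ x, L x (Fin.last n) = σ * x (Fin.last n) := by
    intro x
    have h := L.inner_map_map x e
    rw [hLe', real_inner_smul_right, hlast, hlast] at h
    rw [← h, ← mul_assoc]
    rcases hσ1 with h | h <;> simp [h]
  have hglast : ∀ x, g x (Fin.last n) = 4 * b + σ * x (Fin.last n) := by
    intro x
    have h1 := hL x (engelOffset (n + 1) A b δ 0)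
    have h2 := hLlast (x - engelOffset (n + 1) A b δ 0)
    rw [h1, hg0, PiLp.sub_apply, PiLp.sub_apply, engelOffset_apply_last hA,
      engelOffset_apply_last hA] at h2
    push_cast at h2
    linarith
  have hcoord : ∀ i j, |engelU (n + 1) A i j| ≤ 1 := fun i j =>
    (PiLp.norm_apply_le _ j).trans_eq (norm_engelU hA i)
  have hoff : ∀ i, engelOffset (n + 1) A b δ (2 * i) - engelOffset (n + 1) A b δ (2 * i - 1) =
      (2 * b) • e + δ • engelU (n + 1) A i := by
    intro i
    have h := engelCum_succ (n + 1) A (i - 1)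
    rw [sub_add_cancel] at h
    rw [engelOffset, engelOffset, show 2 * i / 2 = i by omega, show (2 * i - 1) / 2 = i - 1 by omega,
      h]
    push_cast
    module
  have hσ2 : σ = 1 := by
    refine hσ1.resolve_right fun hneg => ?_
    have h1 := sub_engelOffset_mem hA hb (m := 1) (hgX _ (hoff_mem 1)) (by
      rw [hglast, engelOffset_apply_last hA, hneg]; push_cast; ring)
    have h2 : g (engelOffset (n + 1) A b δ 1) = engelOffset (n + 1) A b δ 2 - (2 * b) • e := by
      have h3 := hL (engelOffset (n + 1) A b δ 1) (engelOffset (n + 1) A b δ 0)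
      have h4 : engelOffset (n + 1) A b δ 1 - engelOffset (n + 1) A b δ 0 = (2 * b) • e := by
        simp [engelOffset, he]
      rw [h4, map_smul, hLe', hneg, hg0] at h3
      rw [sub_eq_iff_eq_add'.1 h3.symm]
      module
    have h3 := hoff 1
    norm_num at h3
    have h4 : g (engelOffset (n + 1) A b δ 1) - engelOffset (n + 1) A b δ 1 =
        δ • engelU (n + 1) A 1 := by
      rw [h2, sub_right_comm, h3]
      abel
    rw [h4] at h1
    have h5 := eq_zero_of_mem_engelGridSubgroup h1 fun j => by
      have := hcoord 1 j
      rw [PiLp.smul_apply, smul_eq_mul, abs_mul, abs_of_pos hδ]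
      nlinarith
    exact (smul_ne_zero hδ.ne' (engelU_ne_zero hA 1)) h5
  refine ⟨L, fun i => ?_⟩
  have h1 := sub_engelOffset_mem hA hb (m := 2 * (i + 1)) (hgX _ (hoff_mem (2 * i))) (by
    rw [hglast, engelOffset_apply_last hA, hσ2]; push_cast; ring)
  have h2 := sub_engelOffset_mem hA hb (m := 2 * (i + 1) - 1) (hgX _ (hoff_mem (2 * i - 1))) (by
    rw [hglast, engelOffset_apply_last hA, hσ2]; push_cast; ring)
  have h3 := sub_mem h1 h2
  have h4 : δ • (L (engelU (n + 1) A i) - engelU (n + 1) A (i + 1)) ∈ engelGridSubgroup n a := by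
    have h5 := hL (engelOffset (n + 1) A b δ (2 * i)) (engelOffset (n + 1) A b δ (2 * i - 1))
    rw [hoff, map_add, map_smul, map_smul, hLe', hσ2, one_smul] at h5
    rw [sub_sub_sub_comm, ← h5, hoff, add_sub_add_left_eq_sub, ← smul_sub] at h3
    exact h3
  have h5 := eq_zero_of_mem_engelGridSubgroup h4 fun j => by
    have h6 := hcoord (i + 1) j
    have h7 : |L (engelU (n + 1) A i) j| ≤ 1 := by
      simpa [norm_engelU hA] using PiLp.norm_apply_le (L (engelU (n + 1) A i)) j
    rw [PiLp.smul_apply, smul_eq_mul, abs_mul, abs_of_pos hδ, PiLp.sub_apply]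
    have := abs_sub (L (engelU (n + 1) A i) j) (engelU (n + 1) A (i + 1) j)
    nlinarith
  exact sub_eq_zero.1 ((smul_eq_zero.1 h5).resolve_left hδ.ne')

lemma engelU_add_of_shift (L : Euc (n + 1) ≃ₗᵢ[ℝ] Euc (n + 1))
    (hL : ∀ i, L (engelU (n + 1) A i) = engelU (n + 1) A (i + 1)) {s : ℝ}
    (h0 : engelU (n + 1) A (0 + n) = s • engelU (n + 1) A 0) (i : ℤ) :
    engelU (n + 1) A (i + n) = s • engelU (n + 1) A i := by
  induction i using Int.induction_on with
  | zero => exact h0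
  | succ i ih => rw [add_right_comm, ← hL, ih, map_smul, hL]
  | pred i ih =>
    apply L.injective
    rw [map_smul, hL, hL, add_right_comm, sub_add_cancel, ih]

end EngelSymmetries

/-- Theorem 5.6: for `d ≥ 2` and `0 < δ < a < b`, the Engel set
`X(A,a,b,δ)` is a regular system if and only if either `a_{i+d-1} = a_i` for all `i`
or `a_{i+d-1} = -a_i` for all `i`. -/
theorem engelSet_regular_iff (d : ℕ) (hd : 2 ≤ d) (A : ℤ → ℤ) (hA : EngelSeq d A)
    (a b δ : ℝ) (hδ : 0 < δ) (hδa : δ < a) (hab : a < b) :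
    IsRegularSystem (engelSet d A a b δ) ↔
      ((∀ i : ℤ, A (i + ((d : ℤ) - 1)) = A i) ∨
       (∀ i : ℤ, A (i + ((d : ℤ) - 1)) = -A i)) := by
  obtain ⟨n, rfl⟩ : ∃ n, d = n + 1 := ⟨d - 1, by omega⟩
  have hcast : ((n + 1 : ℕ) : ℤ) - 1 = n := by push_cast; ring
  rw [hcast]
  have hnat : ∀ i, A (i + n) = A i ∨ A (i + n) = -A i := fun i =>
    Int.natAbs_eq_natAbs_iff.1 (hA.periodic_natAbs i)
  have : IsAddTorsionFree (Euc (n + 1)) := .of_isTorsionFree ℝ _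
  constructor
  · intro hreg
    obtain ⟨L, hL⟩ := exists_linearIsometryEquiv_of_isRegularSystem hA hδ hδa hab hreg
    rcases hnat 0 with h0 | h0
    · left
      intro i
      refine (hnat i).resolve_right fun hi => engelU_ne_zero hA i (self_eq_neg.1 ?_)
      have h1 := engelU_add_of_shift L hL (s := 1) (by simpa using engelU_congr h0 (n + 1)) i
      rw [one_smul] at h1
      rw [← engelU_eq_neg hA hi, h1]
    · right
      intro i
      refine (hnat i).resolve_left fun hi => engelU_ne_zero hA i (self_eq_neg.1 ?_)
      have h1 := engelU_add_of_shift L hL (s := -1) (by simpa using engelU_eq_neg hA h0) i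
      rw [neg_one_smul] at h1
      rw [← h1, engelU_congr hi]
  · rintro (h | h)
    · exact isRegularSystem_engelSet (by omega) hA (s := 1) (by norm_num)
        fun i => by rw [one_smul, engelU_congr (h i)]
    · exact isRegularSystem_engelSet (by omega) hA (s := -1) (by norm_num)
        fun i => by rw [neg_one_smul, engelU_eq_neg hA (h i)]
end
end

section
/- Let d ≥ 2 and let R > 0 be fixed. For any ε with 0 < ε < 2dR there exists a Delone set X of type (r,R) in ℝ^d (for suitable r) whose (2dR − ε)-clusters are all mutually equivalent (N_X(2dR − ε) = 1), but which is not a regular system. Consequently the regularity radius satisfies ρ̂_d ≥ 2dR. -/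
noncomputable section
open scoped Pointwise

/-- Horizontal displacement, in units of `δ`, of layer `m` along the `k`-th horizontal axis. -/
def layerShift (n : ℕ) (m : ℤ) (k : Fin n) : ℤ :=
  |(m + 2 * (k : ℤ)) / (2 * (n : ℤ))|

/-- Union of horizontal layers in `ℝ^{n+1}`, layer `m` being the translate at height `2bm` of the
grid `4δℤ^n` by `δ • layerShift n m`. The vertical coordinate has index `0`. Up to the order of the
coordinates this is an Engel set with `a = 2δ`. -/
def layeredSet (n : ℕ) (b δ : ℝ) : Set (Euc (n + 1)) :=
  {x | ∃ m : ℤ, x 0 = 2 * b * m ∧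
    ∀ k : Fin n, ∃ j : ℤ, x k.succ = δ * (4 * j + layerShift n m k)}

lemma exists_signedPerm {d : ℕ} (π : Equiv.Perm (Fin d)) (s : Fin d → ℝ)
    (hs : ∀ i, s i = 1 ∨ s i = -1) :
    ∃ L : Euc d ≃ₗᵢ[ℝ] Euc d, ∀ v i, L v (π i) = s i * v i := by
  classical
  refine ⟨(LinearIsometryEquiv.piLpCongrRight 2 fun i =>
      if s i = 1 then LinearIsometryEquiv.refl ℝ ℝ else LinearIsometryEquiv.neg ℝ).trans
    (LinearIsometryEquiv.piLpCongrLeft 2 ℝ ℝ π), fun v i => ?_⟩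
  rcases hs i with h | h
  · simp [LinearIsometryEquiv.piLpCongrLeft_apply, Equiv.piCongrLeft', h]
  · have h1 : ¬ (-1 : ℝ) = 1 := by norm_num
    simp [LinearIsometryEquiv.piLpCongrLeft_apply, Equiv.piCongrLeft', h, h1]

lemma ediv_window (n : ℕ) (hn : 0 < n) (v : ℤ) :
    ∃ e : ℤ, (e = 1 ∨ e = -1) ∧ ∀ t : ℤ, -n ≤ t → t ≤ n →
      (v + t) / (2 * (n : ℤ)) = v / (2 * (n : ℤ)) ∨
      (v + t) / (2 * (n : ℤ)) = v / (2 * (n : ℤ)) + e := by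
  have hN : (0 : ℤ) < 2 * (n : ℤ) := by omega
  have hr0 := Int.emod_nonneg v hN.ne'
  have hr1 := Int.emod_lt_of_pos v hN
  have hv := Int.emod_add_mul_ediv v (2 * (n : ℤ))
  set r := v % (2 * (n : ℤ))
  set q := v / (2 * (n : ℤ))
  have key (t e : ℤ) (h0 : 0 ≤ r + t - 2 * n * e) (h1 : r + t - 2 * n * e < 2 * n) :
      (v + t) / (2 * (n : ℤ)) = q + e := by
    rw [← hv, show r + 2 * (n : ℤ) * q + t = (r + t - 2 * n * e) + 2 * n * (q + e) by ring,
      Int.add_mul_ediv_left _ _ hN.ne', Int.ediv_eq_zero_of_lt h0 h1, zero_add]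
  rcases lt_or_ge r n with h | h
  · refine ⟨-1, Or.inr rfl, fun t ht0 ht1 => ?_⟩
    rcases lt_or_ge (r + t) 0 with h' | h'
    · exact Or.inr (key t (-1) (by omega) (by omega))
    · exact Or.inl (by simpa using key t 0 (by omega) (by omega))
  · refine ⟨1, Or.inl rfl, fun t ht0 ht1 => ?_⟩
    rcases lt_or_ge (r + t) (2 * n) with h' | h'
    · exact Or.inl (by simpa using key t 0 (by omega) (by omega))
    · exact Or.inr (key t 1 (by omega) (by omega))

lemma abs_ediv_window (n : ℕ) (hn : 0 < n) (v v' τ β : ℤ) (hτ : τ = 1 ∨ τ = -1)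
    (h : ∀ t : ℤ, (v' + τ * t) / (2 * (n : ℤ)) = τ * ((v + t) / (2 * (n : ℤ))) + β) :
    ∃ s : ℤ, (s = 1 ∨ s = -1) ∧ ∀ t : ℤ, -n ≤ t → t ≤ n →
      |(v' + τ * t) / (2 * (n : ℤ))| - |v' / (2 * (n : ℤ))| =
        s * (|(v + t) / (2 * (n : ℤ))| - |v / (2 * (n : ℤ))|) := by
  obtain ⟨e, he, hw⟩ := ediv_window n hn v
  have h0 : v' / (2 * (n : ℤ)) = τ * (v / (2 * (n : ℤ))) + β := by simpa using h 0
  have hs : ∃ s : ℤ, (s = 1 ∨ s = -1) ∧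
      |τ * (v / (2 * (n : ℤ)) + e) + β| - |τ * (v / (2 * (n : ℤ))) + β| =
        s * (|v / (2 * (n : ℤ)) + e| - |v / (2 * (n : ℤ))|) := by
    generalize v / (2 * (n : ℤ)) = q
    by_cases hc : |τ * (q + e) + β| - |τ * q + β| = |q + e| - |q|
    · exact ⟨1, Or.inl rfl, by rw [one_mul, hc]⟩
    · refine ⟨-1, Or.inr rfl, ?_⟩
      rcases hτ with rfl | rfl <;> rcases he with rfl | rfl <;> grind
  obtain ⟨s, hs1, hs⟩ := hs
  refine ⟨s, hs1, fun t ht0 ht1 => ?_⟩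
  rw [h t, h0]
  rcases hw t ht0 ht1 with h' | h' <;> rw [h']
  · simp
  · exact hs

lemma exists_fin_congr (n : ℕ) (hn : 0 < n) (x : ℤ) :
    ∃ (k : Fin n) (z : ℤ), (k : ℤ) = x + n * z := by
  have hn' : (0 : ℤ) < n := by omega
  have h0 := Int.emod_nonneg x hn'.ne'
  have h1 := Int.emod_lt_of_pos x hn'
  refine ⟨⟨(x % n).toNat, by omega⟩, -(x / n), ?_⟩
  have := Int.emod_add_mul_ediv x n
  simp only [Int.toNat_of_nonneg h0]
  linarith

lemma fin_eq_of_sub_eq_mul {n : ℕ} {k l : Fin n} {z : ℤ} (h : (k : ℤ) - l = n * z) : k = l := by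
  have hk := k.2
  have hl := l.2
  have hz : z = 0 := by
    by_contra hz
    rcases lt_or_gt_of_ne hz with hz | hz <;> nlinarith
  subst hz
  ext
  omega

/-- Reflecting and permuting horizontal axes matches the shifts of the layers within distance `n`
of layer `m` with those around layer `m'`. -/
lemma exists_layerShift_matching (n : ℕ) (hn : 0 < n) (m m' : ℤ) :
    ∃ (σ : Equiv.Perm (Fin n)) (τ : ℤ) (s : Fin n → ℤ), (τ = 1 ∨ τ = -1) ∧
      (∀ k, s k = 1 ∨ s k = -1) ∧ ∀ k (t : ℤ), -n ≤ t → t ≤ n →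
        layerShift n (m' + τ * t) (σ k) - layerShift n m' (σ k) =
          s k * (layerShift n (m + t) k - layerShift n m k) := by
  have hN : (0 : ℤ) < 2 * (n : ℤ) := by omega
  obtain ⟨τ, w, hτw⟩ : ∃ τ w : ℤ,
      (τ = 1 ∧ m - m' = 2 * w) ∨ (τ = -1 ∧ m + m' + 1 = 2 * w) := by
    rcases Int.emod_two_eq_zero_or_one (m - m') with h | h
    · exact ⟨1, (m - m') / 2, Or.inl ⟨rfl, by omega⟩⟩
    · exact ⟨-1, (m + m' + 1) / 2, Or.inr ⟨rfl, by omega⟩⟩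
  have hτ : τ = 1 ∨ τ = -1 := hτw.imp And.left And.left
  choose f z hf using fun k : Fin n => exists_fin_congr n hn (τ * (k + w))
  have hinj : Function.Injective f := by
    intro k l hkl
    have hk := hf k
    have hl := hf l
    rw [hkl] at hk
    rcases hτ with rfl | rfl
    · exact fin_eq_of_sub_eq_mul (z := z l - z k) (by linarith)
    · exact fin_eq_of_sub_eq_mul (z := z k - z l) (by linarith)
  have hs (k : Fin n) : ∃ s : ℤ, (s = 1 ∨ s = -1) ∧ ∀ t : ℤ, -n ≤ t → t ≤ n →
      |(m' + 2 * (f k : ℤ) + τ * t) / (2 * (n : ℤ))| - |(m' + 2 * (f k : ℤ)) / (2 * (n : ℤ))| =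
        s * (|(m + 2 * (k : ℤ) + t) / (2 * (n : ℤ))| - |(m + 2 * (k : ℤ)) / (2 * (n : ℤ))|) := by
    rcases hτw with ⟨rfl, hw⟩ | ⟨rfl, hw⟩
    · refine abs_ediv_window n hn _ _ _ (z k) hτ fun t => ?_
      rw [hf k, show m' + 2 * (1 * ((k : ℤ) + w) + n * z k) + 1 * t =
        m + 2 * (k : ℤ) + t + 2 * n * z k by linarith, Int.add_mul_ediv_left _ _ hN.ne', one_mul]
    · refine abs_ediv_window n hn _ _ _ (z k - 1) hτ fun t => ?_
      have hneg (u : ℤ) : (-u - 1) / (2 * (n : ℤ)) = -(u / (2 * (n : ℤ))) - 1 := by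
        have h0 := Int.emod_nonneg u hN.ne'
        have h1 := Int.emod_lt_of_pos u hN
        have hu := Int.emod_add_mul_ediv u (2 * (n : ℤ))
        rw [show -u - 1 = (2 * n - 1 - u % (2 * n)) + 2 * n * (-(u / (2 * (n : ℤ))) - 1) by
            linarith, Int.add_mul_ediv_left _ _ hN.ne',
          Int.ediv_eq_zero_of_lt (by omega) (by omega), zero_add]
      rw [hf k, show m' + 2 * (-1 * ((k : ℤ) + w) + n * z k) + -1 * t =
        -(m + 2 * (k : ℤ) + t) - 1 + 2 * n * z k by linarith,
        Int.add_mul_ediv_left _ _ hN.ne', hneg]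
      ring
  choose s hs1 hs using hs
  refine ⟨Equiv.ofBijective f (Finite.injective_iff_bijective.mp hinj), τ, s, hτ, hs1,
    fun k t ht0 ht1 => ?_⟩
  simpa only [layerShift, Equiv.ofBijective_apply, add_right_comm] using hs k t ht0 ht1

lemma clustersEquiv_layeredSet (n : ℕ) (hn : 0 < n) {b δ ρ : ℝ} (hb : 0 < b)
    (hρ : ρ < 2 * (n + 1) * b) {x x' : Euc (n + 1)} (hx : x ∈ layeredSet n b δ)
    (hx' : x' ∈ layeredSet n b δ) : ClustersEquiv (layeredSet n b δ) x x' ρ := by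
  obtain ⟨m, hx0, hxs⟩ := hx
  obtain ⟨m', hx'0, hx's⟩ := hx'
  choose i hi using hxs
  choose i' hi' using hx's
  obtain ⟨σ, τ, s, hτ, hs, hσ⟩ := exists_layerShift_matching n hn m m'
  obtain ⟨L, hL⟩ := exists_signedPerm (Equiv.Perm.decomposeFin.symm (0, σ))
    (Fin.cons (τ : ℝ) fun k => (s k : ℝ)) (by
      intro k
      refine Fin.cases ?_ (fun k => ?_) k
      · simpa using hτ.imp (fun h => by simp [h]) fun h => by simp [h]
      · simpa using (hs k).imp (fun h => by simp [h]) fun h => by simp [h])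
  have hL0 (v) : L v 0 = τ * v 0 := by simpa using hL v 0
  have hLs (v k) : L v (σ k).succ = s k * v k.succ := by simpa using hL v k.succ
  let g : Euc (n + 1) ≃ᵢ Euc (n + 1) :=
    ((IsometryEquiv.subRight x).trans L.toIsometryEquiv).trans (IsometryEquiv.addRight x')
  have hg (y) : g y = L (y - x) + x' := rfl
  have hgx : g x = x' := by simp [hg]
  have hτ2 : (τ : ℝ) * τ = 1 := by rcases hτ with rfl | rfl <;> simp
  have hmem (y) (hy : dist y x ≤ ρ) : g y ∈ layeredSet n b δ ↔ y ∈ layeredSet n b δ := by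
    have hcoord (t : ℤ) (ht : y 0 = 2 * b * (m + t : ℤ)) (k : Fin n) :
        (∃ j : ℤ, g y (σ k).succ = δ * (4 * j + layerShift n (m' + τ * t) (σ k))) ↔
          ∃ j : ℤ, y k.succ = δ * (4 * j + layerShift n (m + t) k) := by
      have habs : |2 * b * (t : ℝ)| ≤ ρ := by
        have h := PiLp.norm_apply_le (y - x) 0
        rw [← dist_eq_norm, Real.norm_eq_abs] at h
        refine le_trans (le_of_eq ?_) (h.trans hy)
        rw [PiLp.sub_apply, ht, hx0]
        push_cast
        ring_nf
      have ht' : |(t : ℝ)| < n + 1 := by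
        rw [abs_mul, abs_of_pos (by positivity : 0 < 2 * b)] at habs
        by_contra! h
        nlinarith
      have ht'' : |t| < n + 1 := by exact_mod_cast ht'
      rw [abs_lt] at ht''
      have h := hσ k t (by omega) (by omega)
      have h' : (layerShift n (m' + τ * t) (σ k) : ℝ) = layerShift n m' (σ k) +
          s k * (layerShift n (m + t) k - layerShift n m k) := by
        rw [← sub_eq_iff_eq_add']
        exact_mod_cast h
      rw [hg, PiLp.add_apply, hLs, PiLp.sub_apply, hi, hi', h']
      rcases hs k with hk | hk <;> rw [hk]
      · constructor
        · rintro ⟨j, hj⟩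
          refine ⟨j - i' (σ k) + i k, ?_⟩
          push_cast at hj ⊢
          linarith
        · rintro ⟨j, hj⟩
          refine ⟨j + i' (σ k) - i k, ?_⟩
          push_cast at hj ⊢
          linarith
      · constructor
        · rintro ⟨j, hj⟩
          refine ⟨-j + i' (σ k) + i k, ?_⟩
          push_cast at hj ⊢
          linarith
        · rintro ⟨j, hj⟩
          refine ⟨-j + i' (σ k) + i k, ?_⟩
          push_cast at hj ⊢
          linarith
    have hy0 : g y 0 = τ * (y 0 - 2 * b * m) + 2 * b * m' := by
      rw [hg, PiLp.add_apply, hL0, PiLp.sub_apply, hx0, hx'0]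
    constructor
    · rintro ⟨M, hM0, hM⟩
      have ht : y 0 = 2 * b * (m + τ * (M - m') : ℤ) := by
        rw [hy0] at hM0
        push_cast
        linear_combination τ * hM0 - (y 0 - 2 * b * m) * hτ2
      refine ⟨_, ht, fun k => (hcoord _ ht k).1 ?_⟩
      have hM' : m' + τ * (τ * (M - m')) = M := by rcases hτ with rfl | rfl <;> ring
      rw [hM']
      exact hM _
    · rintro ⟨M, hM0, hM⟩
      have ht : y 0 = 2 * b * (m + (M - m) : ℤ) := by rw [hM0]; push_cast; ring
      refine ⟨m' + τ * (M - m), ?_, fun k => ?_⟩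
      · rw [hy0, hM0]
        push_cast
        ring
      · obtain ⟨k, rfl⟩ := σ.surjective k
        refine (hcoord _ ht k).2 ?_
        rw [add_sub_cancel]
        exact hM k
  refine ⟨g, hgx, ?_⟩
  ext y
  obtain ⟨y, rfl⟩ := g.surjective y
  rw [g.injective.mem_set_image]
  have hd : dist (g y) x' = dist y x := by rw [← hgx, g.isometry.dist_eq]
  simp only [cluster, Set.mem_inter_iff, Metric.mem_closedBall, hd]
  exact and_congr_left fun hy => (hmem y hy).symm

lemma isDeloneSet_layeredSet (n : ℕ) {b δ R : ℝ} (hδ : 0 < δ) (hδb : δ ≤ b) (hR : 0 < R)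
    (hbR : b ^ 2 + 4 * n * δ ^ 2 = R ^ 2) : IsDeloneSet (layeredSet n b δ) δ R := by
  have hb : 0 < b := hδ.trans_le hδb
  refine ⟨?_, fun y => ?_⟩
  · rintro y x ⟨⟨m, hx0, hx⟩, hxy⟩ x' ⟨⟨m', hx'0, hx'⟩, hx'y⟩
    have hd : dist x x' < 2 * δ := by
      rw [Metric.mem_ball] at hxy hx'y
      linarith [dist_triangle_right x x' y]
    have hc (k) : |x k - x' k| < 2 * δ := by
      have h := PiLp.norm_apply_le (x - x') k
      rw [← dist_eq_norm, Real.norm_eq_abs, PiLp.sub_apply] at h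
      exact h.trans_lt hd
    have eq_of_abs (c : ℝ) (hc : 2 * δ ≤ c) (u v : ℤ) (h : |c * (u - v)| < 2 * δ) : u = v := by
      rw [abs_mul, abs_of_pos (by linarith : 0 < c)] at h
      have h1 : |(u - v : ℝ)| < 1 := by
        by_contra! h1
        nlinarith
      have h2 : |u - v| < 1 := by exact_mod_cast h1
      linarith [Int.abs_lt_one_iff.mp h2]
    have hm : m = m' := by
      refine eq_of_abs (2 * b) (by linarith) m m' ?_
      rw [mul_sub, ← hx0, ← hx'0]
      exact hc 0
    subst hm
    ext k
    refine Fin.cases (by rw [hx0, hx'0]) (fun k => ?_) k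
    obtain ⟨j, hj⟩ := hx k
    obtain ⟨j', hj'⟩ := hx' k
    have : j = j' := by
      refine eq_of_abs (4 * δ) (by linarith) j j' ?_
      convert hc k.succ using 2
      rw [hj, hj']
      ring
    rw [hj, hj', this]
  · set m : ℤ := round (y 0 / (2 * b))
    set j : Fin n → ℤ := fun k => round ((y k.succ / δ - layerShift n m k) / 4)
    let x : Euc (n + 1) := WithLp.toLp 2 (Fin.cons (2 * b * (m : ℝ)) fun k =>
      δ * (4 * (j k : ℝ) + layerShift n m k))
    have hx0 : x 0 = 2 * b * m := by simp [x]
    have hxs (k : Fin n) : x k.succ = δ * (4 * (j k : ℝ) + layerShift n m k) := by simp [x]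
    refine ⟨x, ⟨m, hx0, fun k => ⟨j k, hxs k⟩⟩, ?_⟩
    rw [Metric.mem_closedBall, EuclideanSpace.dist_eq]
    refine Real.sqrt_le_iff.mpr ⟨hR.le, ?_⟩
    rw [Fin.sum_univ_succ, ← hbR]
    have hsq (k) : dist (x (Fin.succ k)) (y k.succ) ^ 2 ≤ 4 * δ ^ 2 := by
      have h := abs_sub_round ((y k.succ / δ - layerShift n m k) / 4)
      have h' : dist (x (Fin.succ k)) (y k.succ) =
          4 * δ * |(y k.succ / δ - layerShift n m k) / 4 - j k| := by
        rw [← abs_of_pos (by linarith : 0 < 4 * δ), ← abs_mul, dist_comm, Real.dist_eq, hxs]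
        congr 1
        field_simp
        ring
      rw [show 4 * δ ^ 2 = (2 * δ) ^ 2 by ring]
      refine pow_le_pow_left₀ dist_nonneg ?_ 2
      rw [h']
      nlinarith
    have hsq0 : dist (x 0) (y 0) ^ 2 ≤ b ^ 2 := by
      have h := abs_sub_round (y 0 / (2 * b))
      have h' : dist (x 0) (y 0) = 2 * b * |y 0 / (2 * b) - m| := by
        rw [← abs_of_pos (by linarith : 0 < 2 * b), ← abs_mul,
          abs_of_pos (by linarith : 0 < 2 * b), dist_comm, Real.dist_eq, hx0]
        congr 1
        field_simp
      rw [h']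
      gcongr
      nlinarith
    refine add_le_add hsq0 ((Finset.sum_le_sum fun k _ => hsq k).trans (le_of_eq ?_))
    simp
    ring

lemma not_isRegularSystem_layeredSet (n : ℕ) (hn : 0 < n) {b δ : ℝ} (hδ : 0 < δ)
    (hirr : ∀ A B : ℤ, b ^ 2 * A = δ ^ 2 * B → A = 0) :
    ¬ IsRegularSystem (layeredSet n b δ) := by
  have hN : (0 : ℤ) < 2 * (n : ℤ) := by omega
  let p (m : ℤ) : Euc (n + 1) := WithLp.toLp 2 (Fin.cons (2 * b * (m : ℝ)) fun k =>
    δ * layerShift n m k)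
  have hp0 (m) : p m 0 = 2 * b * m := by simp [p]
  have hps (m k) : p m (Fin.succ k) = δ * layerShift n m k := by simp [p]
  have hp (m) : p m ∈ layeredSet n b δ := ⟨m, hp0 m, fun k => ⟨0, by simp [hps]⟩⟩
  have hediv (u q : ℤ) (h0 : 2 * n * q ≤ u) (h1 : u < 2 * n * (q + 1)) :
      u / (2 * (n : ℤ)) = q := by
    rw [show u = (u - 2 * n * q) + 2 * n * q by ring, Int.add_mul_ediv_left _ _ hN.ne',
      Int.ediv_eq_zero_of_lt (by linarith) (by linarith), zero_add]
  have hdist : dist (p (2 * n)) (p (-1)) ^ 2 = 4 * b ^ 2 * (2 * n + 1) ^ 2 + δ ^ 2 * (n - 1) := by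
    obtain ⟨n, rfl⟩ : ∃ l, n = l + 1 := ⟨n - 1, by omega⟩
    rw [EuclideanSpace.dist_eq, Real.sq_sqrt (by positivity), Fin.sum_univ_succ,
      Fin.sum_univ_succ]
    have h1 (k : Fin (n + 1)) : layerShift (n + 1) (2 * (n + 1 : ℕ)) k = 1 := by
      rw [layerShift, hediv _ 1 (by omega) (by have := k.2; omega), abs_one]
    have h2 : layerShift (n + 1) (-1) 0 = 1 := by
      rw [layerShift, hediv _ (-1) (by simp; omega) (by simp)]
      simp
    have h3 (k : Fin n) : layerShift (n + 1) (-1) k.succ = 0 := by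
      have := k.2
      rw [layerShift, hediv _ 0 (by simp; omega) (by simp; omega), abs_zero]
    simp only [Real.dist_eq, sq_abs, hp0, hps, h1, h2, h3]
    simp
    ring
  intro hreg
  obtain ⟨g, hg, hgx⟩ := hreg _ (hp (-1)) _ (hp (4 * n))
  obtain ⟨M, hM0, hM⟩ : g (p (2 * n)) ∈ layeredSet n b δ := hg ▸ Set.mem_image_of_mem g (hp _)
  choose j hj using hM
  rw [← g.isometry.dist_eq, hgx, EuclideanSpace.dist_eq, Real.sq_sqrt (by positivity),
    Fin.sum_univ_succ] at hdist
  set w : Fin n → ℤ := fun k => 4 * j k + layerShift n M k - layerShift n (4 * n) k with hw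
  have hdist' : 4 * b ^ 2 * (M - 4 * n) ^ 2 + δ ^ 2 * ∑ k, (w k : ℝ) ^ 2 =
      4 * b ^ 2 * (2 * n + 1) ^ 2 + δ ^ 2 * (n - 1) := by
    rw [← hdist, Finset.mul_sum]
    congr 1
    · rw [Real.dist_eq, sq_abs, hM0, hp0]
      push_cast
      ring
    · refine Finset.sum_congr rfl fun k _ => ?_
      rw [Real.dist_eq, sq_abs, hj, hps, hw]
      push_cast
      ring
  have hA : 4 * ((M - 4 * n) ^ 2 - (2 * n + 1) ^ 2) = 0 := by
    apply hirr _ (n - 1 - ∑ k, w k ^ 2)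
    push_cast
    linear_combination hdist'
  have hB : ∑ k, w k ^ 2 = n - 1 := by
    have hA' : ((M : ℝ) - 4 * n) ^ 2 = (2 * n + 1) ^ 2 := by
      have : (M - 4 * (n : ℤ)) ^ 2 = (2 * n + 1) ^ 2 := by linarith
      exact_mod_cast this
    rw [hA', add_right_inj] at hdist'
    have := mul_left_cancel₀ (by positivity) hdist'
    exact_mod_cast this
  have hw1 (k : Fin n) : 1 ≤ w k ^ 2 := by
    suffices w k ≠ 0 by
      have := Int.one_le_abs this
      nlinarith [sq_abs (w k)]
    have hk := k.2
    have h4 : layerShift n (4 * n) k = 2 := by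
      rw [layerShift, hediv _ 2 (by omega) (by omega)]
      rfl
    have hM' : (M - 4 * n) ^ 2 = (2 * (n : ℤ) + 1) ^ 2 := by linarith
    have hshift : layerShift n M k = 3 ∨ layerShift n M k = 1 ∨ layerShift n M k = 0 := by
      rcases sq_eq_sq_iff_eq_or_eq_neg.mp hM' with h | h
      · left
        rw [layerShift, hediv _ 3 (by omega) (by omega)]
        rfl
      · right
        rcases Nat.eq_zero_or_pos (k : ℕ) with h0 | h0
        · right
          rw [layerShift, hediv _ 0 (by omega) (by omega)]
          rfl
        · left
          rw [layerShift, hediv _ 1 (by omega) (by omega)]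
          rfl
    simp only [hw, h4]
    omega
  have := Finset.sum_le_sum fun k (_ : k ∈ Finset.univ) => hw1 k
  simp only [hB, Finset.sum_const, Finset.card_univ, Fintype.card_fin, nsmul_eq_mul] at this
  linarith

lemma exists_layer_parameters (n : ℕ) {R ε : ℝ} (hR : 0 < R) (hε : 0 < ε) :
    ∃ b δ : ℝ, 0 < δ ∧ δ ≤ b ∧ b ^ 2 + 4 * n * δ ^ 2 = R ^ 2 ∧ 2 * (n + 1) * (R - b) < ε ∧
      ∀ A B : ℤ, b ^ 2 * A = δ ^ 2 * B → A = 0 := by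
  obtain ⟨N, hN⟩ := exists_nat_gt (8 * n * (n + 1) * R / ε)
  rw [div_lt_iff₀ hε] at hN
  set p : ℝ := √2 + N with hp
  have hirr : Irrational p := irrational_sqrt_two.add_natCast N
  have hp1 : 1 ≤ p := by
    have : (1 : ℝ) ≤ √2 := by rw [Real.one_le_sqrt]; norm_num
    have : (0 : ℝ) ≤ N := by positivity
    linarith
  have hpN : (N : ℝ) ≤ p := le_add_of_nonneg_left (Real.sqrt_nonneg 2)
  have hp0 : 0 < p := by linarith
  have hq : 0 < p + 4 * n := by positivity
  set δ : ℝ := R / √(p + 4 * n) with hδ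
  have hδ0 : 0 < δ := by positivity
  have hδ2 : δ ^ 2 * (p + 4 * n) = R ^ 2 := by
    rw [hδ, div_pow, Real.sq_sqrt hq.le]
    field_simp
  have hb2 : (δ * √p) ^ 2 = δ ^ 2 * p := by rw [mul_pow, Real.sq_sqrt hp0.le]
  refine ⟨δ * √p, δ, hδ0, ?_, ?_, ?_, ?_⟩
  · exact le_mul_of_one_le_right hδ0.le (Real.one_le_sqrt.mpr hp1)
  · rw [hb2, ← hδ2]
    ring
  · set b := δ * √p
    have hb0 : 0 < b := by positivity
    have hbR : b ≤ R := by
      refine abs_le_of_sq_le_sq' ?_ hR.le |>.2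
      rw [hb2, ← hδ2]
      gcongr
      linarith [(Nat.cast_nonneg n : (0 : ℝ) ≤ n)]
    have h1 : R * (R - b) ≤ 4 * n * δ ^ 2 := by nlinarith
    have h2 : p * (R - b) ≤ 4 * n * R := by
      have : δ ^ 2 * p ≤ R ^ 2 := by rw [← hb2]; gcongr
      have : R * (p * (R - b)) ≤ R * (4 * n * R) := by
        calc R * (p * (R - b)) = p * (R * (R - b)) := by ring
          _ ≤ p * (4 * n * δ ^ 2) := by gcongr
          _ = 4 * n * (δ ^ 2 * p) := by ring
          _ ≤ 4 * n * R ^ 2 := by gcongr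
          _ = _ := by ring
      exact le_of_mul_le_mul_left this hR
    have h3 : p * (2 * (n + 1) * (R - b)) < p * ε := by
      calc p * (2 * (n + 1) * (R - b)) = 2 * (n + 1) * (p * (R - b)) := by ring
        _ ≤ 2 * (n + 1) * (4 * n * R) := by gcongr
        _ = 8 * n * (n + 1) * R := by ring
        _ < N * ε := hN
        _ ≤ p * ε := by gcongr
    exact lt_of_mul_lt_mul_left h3 hp0.le
  · intro A B h
    rw [hb2, mul_assoc] at h
    have h' : p * A = B := mul_left_cancel₀ (by positivity) h
    by_contra hA
    exact (hirr.mul_intCast hA) ⟨B, by push_cast; exact h'.symm⟩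

/-- Theorem 5.8: for `d ≥ 2`, fixed `R > 0` and any `0 < ε < 2dR` there
is a non-regular Delone set `X` of type `(r,R)` in `ℝ^d` (for a suitable `r < R`) all of
whose `(2dR - ε)`-clusters are mutually equivalent. Consequently `ρ̂_d ≥ 2dR`. -/
theorem lower_bound_regularity_radius (d : ℕ) (hd : 2 ≤ d) (R : ℝ) (hR : 0 < R)
    (ε : ℝ) (hε : 0 < ε) (hε2 : ε < 2 * (d : ℝ) * R) :
    ∃ r : ℝ, 0 < r ∧ r < R ∧ ∃ X : Set (Euc d), IsDeloneSet X r R ∧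
      (∀ x ∈ X, ∀ x' ∈ X, ClustersEquiv X x x' (2 * (d : ℝ) * R - ε)) ∧
      ¬ IsRegularSystem X := by
  obtain ⟨n, rfl⟩ : ∃ n, d = n + 1 := ⟨d - 1, by omega⟩
  have hn : 0 < n := by omega
  obtain ⟨b, δ, hδ, hδb, hbR, hbε, hirr⟩ := exists_layer_parameters n hR hε
  have hδR : δ < R := by
    have hn' : (1 : ℝ) ≤ n := by exact_mod_cast hn
    refine abs_lt_of_sq_lt_sq' ?_ hR.le |>.2
    nlinarith
  refine ⟨δ, hδ, hδR, layeredSet n b δ, isDeloneSet_layeredSet n hδ hδb hR hbR,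
    fun x hx x' hx' => clustersEquiv_layeredSet n hn (hδ.trans_le hδb) ?_ hx hx',
    not_isRegularSystem_layeredSet n hn hδ hirr⟩
  push_cast
  linarith
end
end
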